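/- arXiv:1909.06752 — 3 statements merged into one kernel-verified Lean document; each statement's English description precedes it below -/
import Mathlib

section
/- Let 𝒞 be a class of graphs that is closed under taking subgraphs and is not nowhere dense. Then there exists r ∈ ℕ such that for every graph H, the class 𝒞 contains the r-subdivision of H. -/
open SimpleGraph

variable {V : Type} {W : Type}

/-- The set of vertices at distance at most `r` from `v` in `G`. -/
def ball (G : SimpleGraph V) (r : ℕ) (v : V) : Set V :=
  {u | ∃ p : G.Walk v u, p.length ≤ r}

/-- `G` has radius at most `r`. -/
def hasRadiusLE (G : SimpleGraph V) (r : ℕ) : Prop :=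
  ∃ u : V, ∀ v : V, ∃ p : G.Walk u v, p.length ≤ r

/-- `H` is a depth-`r` minor of `G`: there are pairwise disjoint branch sets of
radius at most `r`, one for each vertex of `H`, connected appropriately. -/
def IsDepthMinor (r : ℕ) (H : SimpleGraph W) (G : SimpleGraph V) : Prop :=
  ∃ φ : W → Set V,
    (∀ w : W, hasRadiusLE (G.induce (φ w)) r) ∧
    (Pairwise fun w w' => Disjoint (φ w) (φ w')) ∧
    (∀ a b : W, H.Adj a b → ∃ u ∈ φ a, ∃ v ∈ φ b, G.Adj u v)

/-- `H` is a minor of `G` (no restriction on the radius of branch sets). -/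
def IsMinorOf (H : SimpleGraph W) (G : SimpleGraph V) : Prop :=
  ∃ φ : W → Set V,
    (∀ w : W, (G.induce (φ w)).Connected) ∧
    (Pairwise fun w w' => Disjoint (φ w) (φ w')) ∧
    (∀ a b : W, H.Adj a b → ∃ u ∈ φ a, ∃ v ∈ φ b, G.Adj u v)

/-- A bundled finite graph. -/
structure FGraph : Type 1 where
  V : Type
  [fintypeV : Fintype V]
  G : SimpleGraph V

attribute [instance] FGraph.fintypeV

/-- A class of graphs is nowhere dense if for every `r` there is `m` such that
`K_m` is not a depth-`r` minor of any member. -/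
def NowhereDense (C : Set FGraph) : Prop :=
  ∀ r : ℕ, ∃ m : ℕ, ∀ G ∈ C, ¬ IsDepthMinor r (⊤ : SimpleGraph (Fin m)) G.G

/-- A class of graphs has bounded expansion if for every `r` the edge density of
depth-`r` minors of members is bounded. -/
def BoundedExpansion (C : Set FGraph) : Prop :=
  ∀ r : ℕ, ∃ d : ℝ, ∀ G ∈ C, ∀ (n : ℕ) (H : SimpleGraph (Fin n)),
    IsDepthMinor r H G.G → (H.edgeSet.ncard : ℝ) / (n : ℝ) ≤ d

/-- `H` is (isomorphic to) a subgraph of `G`. -/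
def IsSubgraphOf (H G : FGraph) : Prop :=
  ∃ f : H.V → G.V, Function.Injective f ∧ ∀ a b : H.V, H.G.Adj a b → G.G.Adj (f a) (f b)

/-- `N_r^{G-S}(v)`, the ball of radius `r` around `v` in `G - S`, as a subset of `V`. -/
def ballAvoiding (G : SimpleGraph V) (S : Set V) (r : ℕ) (v : V) : Set V :=
  {u | ∃ p : G.Walk v u, p.length ≤ r ∧ ∀ x ∈ p.support, x ∉ S}

/-- `B` is distance-`r` independent in `G - S`: distinct vertices of `B` have
distance greater than `r` in `G - S`. -/
def DistIndepIn (G : SimpleGraph V) (S : Set V) (r : ℕ) (B : Set V) : Prop :=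
  ∀ u ∈ B, ∀ v ∈ B, u ≠ v →
    ∀ p : G.Walk u v, (∀ x ∈ p.support, x ∉ S) → r < p.length

/-- Uniform quasi-wideness. -/
def UniformlyQuasiWide (C : Set FGraph) : Prop :=
  ∀ r : ℕ, ∃ s : ℕ, ∀ m : ℕ, ∃ N : ℕ, ∀ G ∈ C, ∀ A : Set G.V,
    N ≤ A.ncard → ∃ S : Set G.V, S.ncard ≤ s ∧
      ∃ B ⊆ A \ S, m ≤ B.ncard ∧ DistIndepIn G.G S r B

/-- Splitter wins the simple `ℓ`-round radius-`r` splitter game on `G`. -/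
def SplitterWins (r : ℕ) : (ℓ : ℕ) → (V : Type) → SimpleGraph V → Prop
  | 0, V, _ => IsEmpty V
  | (ℓ + 1), _, G =>
      ∀ C : G.Subgraph, hasRadiusLE C.coe r →
        ∃ w ∈ C.verts, SplitterWins r ℓ _ ((C.deleteVerts {w}).coe)

/-- Splitter wins the `ℓ`-round treedepth game on `G`. -/
def TDSplitterWins : (ℓ : ℕ) → (V : Type) → SimpleGraph V → Prop
  | 0, V, _ => IsEmpty V
  | (ℓ + 1), _, G =>
      ∀ c : G.ConnectedComponent, ∃ w ∈ c.supp,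
        TDSplitterWins ℓ _ (G.induce (c.supp \ {w}))

/-- Splitter wins the variant of the `ℓ`-round radius-`r` splitter game in which
she may delete up to `m` vertices per round. -/
def SplitterWinsSets (r m : ℕ) : (ℓ : ℕ) → (V : Type) → SimpleGraph V → Prop
  | 0, V, _ => IsEmpty V
  | (ℓ + 1), _, G =>
      ∀ C : G.Subgraph, hasRadiusLE C.coe r →
        ∃ W ⊆ C.verts, W.ncard ≤ m ∧ SplitterWinsSets r m ℓ _ ((C.deleteVerts W).coe)

/-- `le` is the ancestor order of a rooted forest: a partial order in which the
set of ancestors of any element is a chain. -/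
def IsForestOrder (le : V → V → Prop) : Prop :=
  (∀ v, le v v) ∧ (∀ u v w, le u v → le v w → le u w) ∧
  (∀ u v, le u v → le v u → u = v) ∧
  (∀ v u w, le u v → le w v → le u w ∨ le w u)

/-- `G` has treedepth at most `ℓ`: there is a rooted forest of depth at most `ℓ`
on `V(G)` such that every edge joins an ancestor-descendant pair. -/
def TreedepthLE (G : SimpleGraph V) (ℓ : ℕ) : Prop :=
  ∃ le : V → V → Prop, IsForestOrder le ∧
    (∀ u v, G.Adj u v → le u v ∨ le v u) ∧
    ∀ v, ({u | le u v}).ncard ≤ ℓ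

/-- The treedepth of `G`. -/
noncomputable def treedepth (G : SimpleGraph V) : ℕ := sInf {ℓ | TreedepthLE G ℓ}

/-- `WReach G le r v`: the set of vertices weakly `r`-reachable from `v`
with respect to the linear order `le`. -/
def WReach (G : SimpleGraph V) (le : V → V → Prop) (r : ℕ) (v : V) : Set V :=
  {u | le u v ∧ ∃ p : G.Walk u v, p.IsPath ∧ p.length ≤ r ∧
    ∀ x ∈ p.support, x ≠ u → x ≠ v → le u x ∧ u ≠ x}

/-- `WReachInf G le v`: the set of vertices weakly reachable from `v`
with respect to the linear order `le` (no bound on path length). -/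
def WReachInf (G : SimpleGraph V) (le : V → V → Prop) (v : V) : Set V :=
  {u | le u v ∧ ∃ p : G.Walk u v, p.IsPath ∧
    ∀ x ∈ p.support, x ≠ u → x ≠ v → le u x ∧ u ≠ x}

/-- The weak `r`-coloring number of `G`. -/
noncomputable def wcol (G : SimpleGraph V) (r : ℕ) : ℕ :=
  sInf {k | ∃ le : V → V → Prop, IsLinearOrder V le ∧ ∀ v, (WReach G le r v).ncard ≤ k}

/-- The coloring number of `G`: the least `k` such that some linear order has
every vertex with at most `k - 1` smaller neighbors. -/
noncomputable def coloringNumber (G : SimpleGraph V) : ℕ :=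
  sInf {k | ∃ le : V → V → Prop, IsLinearOrder V le ∧
    ∀ v, ({u | G.Adj u v ∧ le u v ∧ u ≠ v}).ncard + 1 ≤ k}

/-- `X` is an `r`-neighborhood cover of `G` with clusters of radius at most `ρ`:
each cluster induces a connected subgraph of radius at most `ρ`, and every
`r`-ball is contained in some cluster. -/
def IsNbhdCover (G : SimpleGraph V) (r ρ : ℕ) (X : Set (Set V)) : Prop :=
  (∀ C ∈ X, hasRadiusLE (G.induce C) ρ) ∧ ∀ v : V, ∃ C ∈ X, ball G r v ⊆ C

/-- The cluster `X_r[G,π,u] = {w : u ∈ WReach_r[G,π,w]}`. -/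
def XCluster (G : SimpleGraph V) (le : V → V → Prop) (r : ℕ) (u : V) : Set V :=
  {w | u ∈ WReach G le r w}

/-- The smaller endpoint of an edge. -/
def sym2Min {n : ℕ} (e : Sym2 (Fin n)) : Fin n :=
  Sym2.lift ⟨fun a b => min a b, fun _ _ => min_comm _ _⟩ e

/-- The larger endpoint of an edge. -/
def sym2Max {n : ℕ} (e : Sym2 (Fin n)) : Fin n :=
  Sym2.lift ⟨fun a b => max a b, fun _ _ => max_comm _ _⟩ e

/-- The relation generating the `r`-subdivision of `G`. -/
def SubdivRel {n : ℕ} (r : ℕ) (G : SimpleGraph (Fin n)) :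
    (Fin n ⊕ (G.edgeSet × Fin r)) → (Fin n ⊕ (G.edgeSet × Fin r)) → Prop
  | Sum.inl a, Sum.inl b => r = 0 ∧ G.Adj a b
  | Sum.inl a, Sum.inr ei => ((ei.2 : ℕ) = 0 ∧ a = sym2Min ei.1.1) ∨
      ((ei.2 : ℕ) = r - 1 ∧ a = sym2Max ei.1.1)
  | Sum.inr ei, Sum.inr ej => ei.1 = ej.1 ∧ (ei.2 : ℕ) + 1 = (ej.2 : ℕ)
  | Sum.inr _, Sum.inl _ => False

/-- The `r`-subdivision of `G`: every edge is replaced by a path with `r`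
internal vertices. -/
def Subdivision {n : ℕ} (r : ℕ) (G : SimpleGraph (Fin n)) :
    SimpleGraph ((Fin n) ⊕ (G.edgeSet × Fin r)) :=
  SimpleGraph.fromRel (SubdivRel r G)

/-- Ramsey's theorem for pairs and finitely many colors, with asymmetric clique sizes. -/
theorem exists_monochromatic_of_le_card (c : ℕ) : ∀ (d : ℕ) (k : Fin c → ℕ), ∑ i, k i = d →
    ∃ N : ℕ, ∀ {α : Type} [LinearOrder α] (S : Finset α) (f : α → α → Fin c), N ≤ S.card →
      ∃ col, ∃ T ⊆ S, T.card = k col ∧ ∀ a ∈ T, ∀ b ∈ T, a < b → f a b = col := by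
  intro d
  induction d with
  | zero =>
    intro k hk
    refine ⟨1, fun {α} _ S f hS ↦ ?_⟩
    obtain ⟨a, -⟩ := Finset.card_pos.1 hS
    refine ⟨f a a, ∅, by simp, ?_, by simp⟩
    have := (Finset.sum_eq_zero_iff.1 hk) (f a a) (Finset.mem_univ _)
    simp [this]
  | succ d ih =>
    intro k hk
    by_cases h0 : ∃ i, k i = 0
    · obtain ⟨i, hi⟩ := h0
      exact ⟨0, fun S f _ ↦ ⟨i, ∅, by simp, by simp [hi], by simp⟩⟩
    push Not at h0
    have hsum : ∀ i, ∑ j, Function.update k i (k i - 1) j = d := by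
      intro i
      rw [Finset.sum_update_of_mem (Finset.mem_univ i)]
      have h1 := Finset.add_sum_erase Finset.univ k (Finset.mem_univ i)
      rw [Finset.erase_eq] at h1
      have := Nat.pos_of_ne_zero (h0 i)
      omega
    choose N hN using fun i ↦ ih _ (hsum i)
    refine ⟨1 + ∑ i, N i, fun {α} _ S f hS ↦ ?_⟩
    have hne : S.Nonempty := Finset.card_pos.1 (by omega)
    set v := S.min' hne with hv
    have hvS : v ∈ S := S.min'_mem hne
    obtain ⟨i, hi⟩ : ∃ i, N i ≤ ((S.erase v).filter fun a ↦ f v a = i).card := by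
      by_contra! hlt
      have h1 := Finset.card_eq_sum_card_fiberwise (f := f v) (s := S.erase v)
        (t := Finset.univ) (fun _ _ ↦ by simp)
      rw [Finset.card_erase_of_mem hvS] at h1
      have h2 : ∑ i, ((S.erase v).filter fun a ↦ f v a = i).card ≤ ∑ i, N i :=
        Finset.sum_le_sum fun i _ ↦ (hlt i).le
      have h3 : 0 < c := Fin.pos (f v v)
      have h4 : ∑ i, ((S.erase v).filter fun a ↦ f v a = i).card < ∑ i, N i :=
        Finset.sum_lt_sum_of_nonempty ⟨f v v, Finset.mem_univ _⟩ fun i _ ↦ hlt i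
      omega
    obtain ⟨col, T, hT, hcard, hmono⟩ := hN i _ f hi
    by_cases hcol : col = i
    · subst hcol
      have hvT : v ∉ T := fun h ↦ by simpa using hT h
      refine ⟨col, insert v T, ?_, ?_, ?_⟩
      · intro x hx
        rcases Finset.mem_insert.1 hx with rfl | hx
        · exact hvS
        · exact Finset.mem_of_mem_erase (Finset.mem_filter.1 (hT hx)).1
      · rw [Finset.card_insert_of_notMem hvT, hcard, Function.update_self]
        have := Nat.pos_of_ne_zero (h0 col)
        omega
      · intro a ha b hb hab
        rcases Finset.mem_insert.1 hb with rfl | hb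
        · have haS : a ∈ S := by
            rcases Finset.mem_insert.1 ha with rfl | ha
            · exact hvS
            · exact Finset.mem_of_mem_erase (Finset.mem_filter.1 (hT ha)).1
          exact absurd hab (not_lt.2 (S.min'_le a haS))
        · rcases Finset.mem_insert.1 ha with rfl | ha
          · exact (Finset.mem_filter.1 (hT hb)).2
          · exact hmono a ha b hb hab
    · refine ⟨col, T, fun x hx ↦ Finset.mem_of_mem_erase (Finset.mem_filter.1 (hT hx)).1, ?_, hmono⟩
      rw [hcard, Function.update_of_ne hcol]

/-- `L` is the support of a walk of length at most `k` from `u` to `x`. -/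
def IsWalkSupport {V : Type} (G : SimpleGraph V) (k : ℕ) (u x : V) (L : List V) : Prop :=
  ∃ w : G.Walk u x, w.length ≤ k ∧ w.support = L

/-- There are walks of length at most `r` inside `X` from `v` to all the vertices `t j`, `j ∈ A`,
that pairwise meet only in `v`. -/
def IsFan {V ι : Type} (G : SimpleGraph V) (r : ℕ) (X : Set V) (v : V) (t : ι → V)
    (A : Finset ι) : Prop :=
  ∃ Q : ι → List V, (∀ j ∈ A, IsWalkSupport G r v (t j) (Q j) ∧ ∀ x ∈ Q j, x ∈ X) ∧
    ∀ j ∈ A, ∀ j' ∈ A, j ≠ j' → ∀ x ∈ Q j, x ∈ Q j' → x = v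

theorem IsFan.mono {V ι : Type} {G : SimpleGraph V} {r : ℕ} {X : Set V} {v : V} {t : ι → V}
    {A B : Finset ι} (h : IsFan G r X v t A) (hBA : B ⊆ A) : IsFan G r X v t B := by
  obtain ⟨Q, h1, h2⟩ := h
  exact ⟨Q, fun j hj ↦ h1 j (hBA hj), fun j hj j' hj' ↦ h2 j (hBA hj) j' (hBA hj')⟩

theorem IsWalkSupport.exists_of_mem {V : Type} {G : SimpleGraph V} {k : ℕ} {u x y : V}
    {L : List V} (h : IsWalkSupport G (k + 1) u x L) (hy : y ∈ L) (hne : y ≠ u) :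
    ∃ L', IsWalkSupport G k y x L' ∧ L' ⊆ L := by
  classical
  obtain ⟨w, hw, rfl⟩ := h
  refine ⟨_, ⟨w.dropUntil y hy, ?_, rfl⟩, w.support_dropUntil_subset_support hy⟩
  have h1 := congrArg Walk.length (w.take_spec hy)
  rw [Walk.length_append] at h1
  have h2 : (w.takeUntil y hy).length ≠ 0 := fun h ↦ hne (Walk.eq_of_length_eq_zero h).symm
  omega

/-- Sufficiently many walks of bounded length from a common vertex contain a large fan. -/
theorem exists_isFan_of_le_card (M : ℕ) : ∀ r : ℕ, ∃ N : ℕ, ∀ {V ι : Type} (G : SimpleGraph V)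
    (X : Set V) (u : V) (t : ι → V) (A : Finset ι), u ∈ X →
    (∀ j ∈ A, ∃ L, IsWalkSupport G r u (t j) L ∧ ∀ x ∈ L, x ∈ X) → N ≤ A.card →
      ∃ v ∈ X, ∃ B ⊆ A, B.card = M ∧ IsFan G r X v t B := by
  classical
  intro r
  induction r with
  | zero =>
    refine ⟨M, fun {V ι} G X u t A hu hL hA ↦ ?_⟩
    obtain ⟨B, hBA, hB⟩ := Finset.exists_subset_card_eq hA
    choose! Q hQ using hL
    refine ⟨u, hu, B, hBA, hB, Q, fun j hj ↦ hQ j (hBA hj), fun j hj j' _ _ x hx _ ↦ ?_⟩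
    obtain ⟨⟨w, hw, hs⟩, -⟩ := hQ j (hBA hj)
    rw [← hs] at hx
    have : w.support = [u] := by
      cases w with
      | nil => rfl
      | cons h p => simp at hw
    simpa [this] using hx
  | succ r ih =>
    obtain ⟨N, hN⟩ := ih
    refine ⟨M + (M * (r + 2)) * N + 1, fun {V ι} G X u t A hu hL hA ↦ ?_⟩
    choose! Q hQ using hL
    let good : Finset ι → Prop := fun B ↦
      ∀ j ∈ B, ∀ j' ∈ B, j ≠ j' → ∀ x ∈ Q j, x ∈ Q j' → x = u
    obtain ⟨B, hB, hmax⟩ := Finset.exists_max_image (A.powerset.filter good) Finset.card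
      ⟨∅, by simp [good]⟩
    rw [Finset.mem_filter, Finset.mem_powerset] at hB
    obtain ⟨hBA, hBgood⟩ := hB
    rcases le_or_gt M B.card with hM | hM
    · obtain ⟨B', hB', hcard⟩ := Finset.exists_subset_card_eq hM
      exact ⟨u, hu, B', hB'.trans hBA, hcard,
        IsFan.mono ⟨Q, fun j hj ↦ hQ j (hBA hj), hBgood⟩ hB'⟩
    let U : Finset V := B.biUnion fun j ↦ (Q j).toFinset.erase u
    have hU : U.card ≤ M * (r + 2) := by
      refine (Finset.card_biUnion_le_card_mul _ _ (r + 2) fun j hj ↦ ?_).trans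
        (Nat.mul_le_mul_right _ hM.le)
      obtain ⟨⟨w, hw, hs⟩, -⟩ := hQ j (hBA hj)
      refine (Finset.card_le_card (Finset.erase_subset _ _)).trans
        ((List.toFinset_card_le _).trans ?_)
      rw [← hs, Walk.length_support]
      omega
    have hhit : ∀ j ∈ A \ B, ∃ y ∈ U, y ∈ Q j := by
      intro j hj
      rw [Finset.mem_sdiff] at hj
      by_contra! hno
      have hgood : good (insert j B) := by
        have key : ∀ b ∈ B, ∀ x ∈ Q j, x ∈ Q b → x = u := by
          intro b hb x hx hxb
          by_contra hxu
          exact hno x (Finset.mem_biUnion.2 ⟨b, hb, by simp [hxu, hxb]⟩) hx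
        intro a ha b hb hab x hxa hxb
        rcases Finset.mem_insert.1 ha with rfl | haB <;>
          rcases Finset.mem_insert.1 hb with rfl | hbB
        · exact absurd rfl hab
        · exact key b hbB x hxa hxb
        · exact key a haB x hxb hxa
        · exact hBgood a haB b hbB hab x hxa hxb
      have := hmax (insert j B) (Finset.mem_filter.2 ⟨Finset.mem_powerset.2
        (Finset.insert_subset hj.1 hBA), hgood⟩)
      rw [Finset.card_insert_of_notMem hj.2] at this
      omega
    have hAB : (M * (r + 2)) * N < (A \ B).card := by
      have := Finset.le_card_sdiff B A
      omega
    have : Nonempty V := ⟨u⟩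
    choose! y hyU hyQ using hhit
    obtain ⟨v, hvU, hv⟩ := Finset.exists_lt_card_fiber_of_mul_lt_card_of_maps_to hyU
      ((Nat.mul_le_mul_right N hU).trans_lt hAB)
    obtain ⟨b, hb, hvb⟩ := Finset.mem_biUnion.1 hvU
    rw [Finset.mem_erase, List.mem_toFinset] at hvb
    obtain ⟨z, hz, F, hF, hFcard, hFan⟩ := hN G X v t ((A \ B).filter fun j ↦ y j = v)
      ((hQ b (hBA hb)).2 v hvb.2) (fun j hj ↦ by
        rw [Finset.mem_filter] at hj
        have hjA := (Finset.mem_sdiff.1 hj.1).1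
        have hvj := hyQ j hj.1
        rw [hj.2] at hvj
        obtain ⟨L, hL, hsub⟩ := (hQ j hjA).1.exists_of_mem hvj hvb.1
        exact ⟨L, hL, fun x hx ↦ (hQ j hjA).2 x (hsub hx)⟩) hv.le
    refine ⟨z, hz, F, fun j hj ↦ (Finset.mem_sdiff.1 (Finset.mem_filter.1 (hF hj)).1).1, hFcard, ?_⟩
    obtain ⟨Q', h1, h2⟩ := hFan
    refine ⟨Q', fun j hj ↦ ⟨?_, (h1 j hj).2⟩, h2⟩
    obtain ⟨w, hw, hs⟩ := (h1 j hj).1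
    exact ⟨w, hw.trans (Nat.le_succ r), hs⟩

/-- In a large family of branch sets one finds `n` of them with fans to `M` common others. -/
theorem exists_isFan_family (r : ℕ) : ∀ n M : ℕ, ∃ K : ℕ, ∀ {V ι : Type} (G : SimpleGraph V)
    (φ : ι → Set V) (t : ι → ι → V),
    (∀ i, ∃ u ∈ φ i, ∀ j, ∃ L, IsWalkSupport G r u (t i j) L ∧ ∀ x ∈ L, x ∈ φ i) →
    ∀ A : Finset ι, K ≤ A.card → ∃ I B : Finset ι, I ⊆ A ∧ B ⊆ A ∧ Disjoint I B ∧
      I.card = n ∧ M ≤ B.card ∧ ∀ i ∈ I, ∃ v ∈ φ i, IsFan G r (φ i) v (t i) B := by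
  classical
  intro n M
  induction n with
  | zero => exact ⟨M, fun G φ t _ A hA ↦ ⟨∅, A, by simp, by simp, by simp, by simp, hA, by simp⟩⟩
  | succ n ih =>
    obtain ⟨K, hK⟩ := ih
    obtain ⟨N, hN⟩ := exists_isFan_of_le_card K r
    refine ⟨N + 1, fun {V ι} G φ t h A hA ↦ ?_⟩
    obtain ⟨i, hi⟩ := Finset.card_pos.1 (by omega : 0 < A.card)
    obtain ⟨u, hu, hw⟩ := h i
    obtain ⟨v, hv, A', hA', hcard, hfan⟩ := hN G (φ i) u (t i) (A.erase i) hu (fun j _ ↦ hw j)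
      (by rw [Finset.card_erase_of_mem hi]; omega)
    obtain ⟨I, B, hI, hB, hd, hIc, hBc, hF⟩ := hK G φ t h A' hcard.ge
    have hiA' : i ∉ A' := fun h ↦ by simpa using hA' h
    have hsub : A' ⊆ A := hA'.trans (Finset.erase_subset _ _)
    refine ⟨insert i I, B, Finset.insert_subset hi (hI.trans hsub), hB.trans hsub, ?_, ?_, hBc, ?_⟩
    · rw [Finset.disjoint_insert_left]
      exact ⟨fun h ↦ hiA' (hB h), hd⟩
    · rw [Finset.card_insert_of_notMem fun h ↦ hiA' (hI h), hIc]
    · intro j hj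
      rcases Finset.mem_insert.1 hj with rfl | hj
      · exact ⟨v, hv, hfan.mono hB⟩
      · exact hF j hj

/-- `G` contains the `s`-subdivision of the complete graph on `n` vertices: `c` gives the branch
vertices and `p a b` lists the vertices of the path from `c a` to `c b`. -/
def HasSubdividedClique {V : Type} (G : SimpleGraph V) (s n : ℕ) : Prop :=
  ∃ (c : Fin n → V) (p : Fin n → Fin n → ℕ → V), Function.Injective c ∧
    (∀ a b, a < b → p a b 0 = c a ∧ p a b (s + 1) = c b ∧
      (∀ i ≤ s, G.Adj (p a b i) (p a b (i + 1))) ∧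
      ∀ i, 1 ≤ i → i ≤ s → ∀ x, p a b i ≠ c x) ∧
    ∀ a b a' b', a < b → a' < b' → ∀ i i', 1 ≤ i → i ≤ s → 1 ≤ i' → i' ≤ s →
      p a b i = p a' b' i' → a = a' ∧ b = b' ∧ i = i'

theorem HasSubdividedClique.mono {V : Type} {G : SimpleGraph V} {s n k : ℕ}
    (h : HasSubdividedClique G s n) (hk : k ≤ n) : HasSubdividedClique G s k := by
  obtain ⟨c, p, hc, h1, h2⟩ := h
  let e := Fin.castLEEmb hk
  have he : ∀ {a b}, a < b → e a < e b := fun h ↦ h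
  refine ⟨c ∘ e, fun a b ↦ p (e a) (e b), hc.comp e.injective, ?_, ?_⟩
  · intro a b hab
    obtain ⟨h3, h4, h5, h6⟩ := h1 _ _ (he hab)
    exact ⟨h3, h4, h5, fun i hi hi' x ↦ h6 i hi hi' (e x)⟩
  · intro a b a' b' hab hab' i i' hi1 hi2 hi3 hi4 heq
    obtain ⟨h3, h4, h5⟩ := h2 _ _ _ _ (he hab) (he hab') i i' hi1 hi2 hi3 hi4 heq
    exact ⟨e.injective h3, e.injective h4, h5⟩

theorem sym2Min_lt_sym2Max {n : ℕ} {H : SimpleGraph (Fin n)} (e : H.edgeSet) :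
    sym2Min e.1 < sym2Max e.1 := by
  obtain ⟨e, he⟩ := e
  induction e using Sym2.ind with
  | _ a b =>
    rw [sym2Min, sym2Max, Sym2.lift_mk, Sym2.lift_mk]
    exact min_lt_max.2 (H.ne_of_adj he)

theorem eq_of_sym2Min_eq_of_sym2Max_eq {n : ℕ} {e f : Sym2 (Fin n)}
    (h1 : sym2Min e = sym2Min f) (h2 : sym2Max e = sym2Max f) : e = f := by
  induction e using Sym2.ind with
  | _ a b =>
    induction f using Sym2.ind with
    | _ c d =>
      simp only [sym2Min, sym2Max, Sym2.lift_mk] at h1 h2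
      rw [Sym2.eq_iff]
      grind

/-- A graph with a subdivided clique contains the subdivisions of all graphs of that order. -/
theorem HasSubdividedClique.exists_embedding {V : Type} {G : SimpleGraph V} {s n : ℕ}
    (h : HasSubdividedClique G s n) (H : SimpleGraph (Fin n)) :
    ∃ f : Fin n ⊕ (H.edgeSet × Fin s) → V, Function.Injective f ∧
      ∀ x y, (Subdivision s H).Adj x y → G.Adj (f x) (f y) := by
  obtain ⟨c, p, hc, h1, h2⟩ := h
  refine ⟨Sum.elim c fun ei ↦ p (sym2Min ei.1.1) (sym2Max ei.1.1) (ei.2 + 1), ?_, ?_⟩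
  · rintro (a | ⟨e, i⟩) (b | ⟨f, j⟩) hab
    · exact congrArg _ (hc hab)
    · exact absurd hab.symm ((h1 _ _ (sym2Min_lt_sym2Max f)).2.2.2 _ (by omega) (by omega) a)
    · exact absurd hab ((h1 _ _ (sym2Min_lt_sym2Max e)).2.2.2 _ (by omega) (by omega) b)
    · obtain ⟨h3, h4, h5⟩ := h2 _ _ _ _ (sym2Min_lt_sym2Max e) (sym2Min_lt_sym2Max f) _ _
        (by omega) (by omega) (by omega) (by omega) hab
      have he : e = f := Subtype.ext (eq_of_sym2Min_eq_of_sym2Max_eq h3 h4)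
      have hi : i = j := Fin.ext (by simpa using h5)
      rw [he, hi]
  · have key : ∀ x y, SubdivRel s H x y → G.Adj
        (Sum.elim c (fun ei ↦ p (sym2Min ei.1.1) (sym2Max ei.1.1) (ei.2 + 1)) x)
        (Sum.elim c (fun ei ↦ p (sym2Min ei.1.1) (sym2Max ei.1.1) (ei.2 + 1)) y) := by
      rintro (a | ⟨e, i⟩) (b | ⟨f, j⟩) hab
      · obtain ⟨rfl, hab⟩ := hab
        have main : ∀ a b, a < b → G.Adj (c a) (c b) := by
          intro a b hlt
          obtain ⟨h3, h4, h5, -⟩ := h1 a b hlt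
          have := h5 0 le_rfl
          rwa [h3, h4] at this
        rcases lt_or_gt_of_ne (H.ne_of_adj hab) with hlt | hlt
        · exact main a b hlt
        · exact (main b a hlt).symm
      · obtain ⟨h3, h4, h5, -⟩ := h1 _ _ (sym2Min_lt_sym2Max f)
        rcases hab with ⟨hj, rfl⟩ | ⟨hj, rfl⟩
        · have := h5 0 (Nat.zero_le _)
          simp only at hj
          simpa [h3, hj] using this
        · simp only at hj
          have hs := j.2
          have := h5 s le_rfl
          rw [h4] at this
          have hjs : (j : ℕ) + 1 = s := by omega
          simpa [hjs] using this.symm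
      · exact hab.elim
      · obtain ⟨he, hij⟩ := hab
        simp only at he hij
        subst he
        obtain ⟨-, -, h5, -⟩ := h1 _ _ (sym2Min_lt_sym2Max e)
        have := h5 (i + 1) (by omega)
        simpa [hij] using this
    intro x y hxy
    rw [Subdivision, SimpleGraph.fromRel_adj] at hxy
    rcases hxy.2 with h | h
    · exact key x y h
    · exact (key y x h).symm

theorem exists_walk_of_walk_induce {V : Type} {G : SimpleGraph V} {X : Set V} {a b : X}
    (q : (G.induce X).Walk a b) :
    ∃ p : G.Walk (a : V) b, p.length = q.length ∧ ∀ x ∈ p.support, x ∈ X := by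
  induction q with
  | nil => exact ⟨Walk.nil, rfl, by simp⟩
  | @cons u v w h q ih =>
    obtain ⟨p, hp, hs⟩ := ih
    have h' : G.Adj u v := h
    refine ⟨Walk.cons h' p, by rw [Walk.length_cons, Walk.length_cons, hp], fun x hx ↦ ?_⟩
    rw [Walk.support_cons, List.mem_cons] at hx
    rcases hx with rfl | hx
    · exact u.2
    · exact hs x hx

/-- Two fans ending in neighbours of a branch set of small radius can be joined to a path. -/
theorem exists_path_through_branch_set {V : Type} {G : SimpleGraph V} {r : ℕ} {X : Set V}
    {v v' t t' s s' : V} {L L' : List V} (hX : hasRadiusLE (G.induce X) r) (hs : s ∈ X)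
    (hs' : s' ∈ X) (hL : IsWalkSupport G r v t L) (hL' : IsWalkSupport G r v' t' L')
    (hts : G.Adj t s) (hts' : G.Adj t' s') (hne : v ≠ v') :
    ∃ l ≤ 4 * r + 1, ∃ f : ℕ → V, f 0 = v ∧ f (l + 1) = v' ∧
      (∀ i ≤ l, G.Adj (f i) (f (i + 1))) ∧ Set.InjOn f {i | i ≤ l + 1} ∧
      ∀ i, f i ∈ L ∨ f i ∈ X ∨ f i ∈ L' := by
  classical
  obtain ⟨w, hw, rfl⟩ := hL
  obtain ⟨w', hw', rfl⟩ := hL'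
  obtain ⟨u, hu⟩ := hX
  obtain ⟨q, hq⟩ := hu ⟨s, hs⟩
  obtain ⟨q', hq'⟩ := hu ⟨s', hs'⟩
  obtain ⟨m, hml, hm⟩ := exists_walk_of_walk_induce (q.reverse.append q')
  rw [Walk.length_append, Walk.length_reverse] at hml
  let W : G.Walk v v' := w.append (Walk.cons hts (m.append (Walk.cons hts'.symm w'.reverse)))
  have hWs : ∀ x ∈ W.support, x ∈ w.support ∨ x ∈ X ∨ x ∈ w'.support := by
    intro x hx
    simp only [W, Walk.mem_support_append_iff, Walk.support_cons, List.mem_cons,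
      Walk.support_reverse, List.mem_reverse] at hx
    rcases hx with hx | rfl | hx | rfl | hx
    · exact Or.inl hx
    · exact Or.inl w.end_mem_support
    · exact Or.inr (Or.inl (hm x hx))
    · exact Or.inr (Or.inl hs')
    · exact Or.inr (Or.inr hx)
  have hWl : W.length ≤ 4 * r + 2 := by
    simp only [W, Walk.length_append, Walk.length_cons, Walk.length_reverse]
    omega
  have hP := W.bypass_isPath
  have hl := W.length_bypass_le_length
  have hpos : W.bypass.length ≠ 0 := fun h ↦ hne (Walk.eq_of_length_eq_zero h)
  have hlen : W.bypass.length - 1 + 1 = W.bypass.length := by omega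
  refine ⟨W.bypass.length - 1, by omega, W.bypass.getVert, by simp, by simp [hlen], ?_, ?_, ?_⟩
  · intro i hi
    exact W.bypass.adj_getVert_succ (by omega)
  · rw [hlen]
    exact hP.getVert_injOn
  · intro i
    exact hWs _ (W.support_bypass_subset_support (W.bypass.getVert_mem_support i))

/-- Graphs with large complete depth-`r` minors contain uniformly subdivided cliques. -/
theorem exists_hasSubdividedClique_of_isDepthMinor (r n : ℕ) : ∃ m : ℕ, ∀ {V : Type}
    (G : SimpleGraph V), IsDepthMinor r (⊤ : SimpleGraph (Fin m)) G →
      ∃ s ≤ 4 * r + 1, HasSubdividedClique G s n := by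
  classical
  obtain ⟨N, hN⟩ := exists_monochromatic_of_le_card (4 * r + 2) _ (fun _ ↦ n) rfl
  obtain ⟨K, hK⟩ := exists_isFan_family r N (N * N)
  refine ⟨K + 1, fun {V} G ⟨φ, hrad, hdisj, hadj⟩ ↦ ?_⟩
  have hne : ∀ i, (φ i).Nonempty := fun i ↦ by
    obtain ⟨u, -⟩ := hrad i
    exact ⟨u, u.2⟩
  have : Nonempty V := ⟨(hne 0).some⟩
  have hts : ∀ i j, ∃ t ∈ φ i, ∃ s ∈ φ j, i ≠ j → G.Adj t s := by
    intro i j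
    by_cases hij : i = j
    · exact ⟨_, (hne i).some_mem, _, (hne j).some_mem, fun h ↦ absurd hij h⟩
    · obtain ⟨t, ht, s, hs, h⟩ := hadj i j hij
      exact ⟨t, ht, s, hs, fun _ ↦ h⟩
  choose t ht s hs hadj' using hts
  have hmem : ∀ {i j x}, x ∈ φ i → x ∈ φ j → i = j := by
    intro i j x hi hj
    by_contra hij
    exact Set.disjoint_left.1 (hdisj hij) hi hj
  obtain ⟨I, B, -, -, hIB, hI, hB, hfan⟩ := hK G φ t (fun i ↦ by
    obtain ⟨u, hu⟩ := hrad i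
    refine ⟨u, u.2, fun j ↦ ?_⟩
    obtain ⟨q, hq⟩ := hu ⟨t i j, ht i j⟩
    obtain ⟨p, hp, hps⟩ := exists_walk_of_walk_induce q
    exact ⟨_, ⟨p, by omega, rfl⟩, hps⟩) Finset.univ (by simp)
  choose! v hv Q hQ hQd using hfan
  have hIBne : ∀ {i j}, i ∈ I → j ∈ B → i ≠ j := fun hi hj h ↦
    Finset.disjoint_left.1 hIB hi (h ▸ hj)
  obtain ⟨g⟩ : Nonempty ((I ×ˢ I : Finset _) ↪ B) := by
    apply Function.Embedding.nonempty_of_card_le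
    rw [Fintype.card_coe, Fintype.card_coe, Finset.card_product, hI]
    exact hB
  have hpath : ∀ k l, k ∈ I ∧ l ∈ I ∧ k < l → ∃ j ∈ B, ∃ len ≤ 4 * r + 1, ∃ f : ℕ → V,
      (∀ h : (k, l) ∈ I ×ˢ I, j = g ⟨(k, l), h⟩) ∧ f 0 = v k ∧ f (len + 1) = v l ∧
      (∀ i ≤ len, G.Adj (f i) (f (i + 1))) ∧ Set.InjOn f {i | i ≤ len + 1} ∧
      ∀ i, f i ∈ Q k j ∨ f i ∈ φ j ∨ f i ∈ Q l j := by
    rintro k l ⟨hk, hl, hkl⟩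
    have hkl' : (k, l) ∈ I ×ˢ I := Finset.mk_mem_product hk hl
    obtain ⟨⟨j, hj⟩, hg⟩ : ∃ x, g ⟨(k, l), hkl'⟩ = x := ⟨_, rfl⟩
    obtain ⟨len, hlen, f, hf⟩ := exists_path_through_branch_set (hrad j) (hs k j) (hs l j)
      (hQ k hk j hj).1 (hQ l hl j hj).1 (hadj' k j (hIBne hk hj)) (hadj' l j (hIBne hl hj))
      (fun h ↦ hkl.ne (hmem (hv k hk) (h ▸ hv l hl)))
    exact ⟨j, hj, len, hlen, f, fun _ ↦ by rw [hg], hf⟩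
  choose! J hJ len hlen f hJg hf0 hf1 hfadj hfinj hfmem using hpath
  obtain ⟨col, T, hTI, hTc, hT⟩ := hN I (fun k l ↦ Fin.ofNat _ (len k l)) hI.ge
  let e := T.orderEmbOfFin hTc
  have heI : ∀ a, e a ∈ I := fun a ↦ hTI (T.orderEmbOfFin_mem hTc a)
  have hpre : ∀ {a b}, a < b → e a ∈ I ∧ e b ∈ I ∧ e a < e b :=
    fun h ↦ ⟨heI _, heI _, e.strictMono h⟩
  have hcol : ∀ a b, a < b → len (e a) (e b) = col := by
    intro a b hab
    have h1 := hT (e a) (T.orderEmbOfFin_mem hTc a) (e b) (T.orderEmbOfFin_mem hTc b)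
      (e.strictMono hab)
    rw [← h1, Fin.val_ofNat, Nat.mod_eq_of_lt]
    have := hlen _ _ (hpre hab)
    omega
  -- The only branch vertices on a connecting path are its ends.
  have hend : ∀ {a b x i}, a < b → f (e a) (e b) i = v (e x) → x = a ∨ x = b := by
    intro a b x i hab hx
    have hxφ := hv (e x) (heI x)
    rw [← hx] at hxφ
    have hjB := hJ _ _ (hpre hab)
    rcases hfmem _ _ (hpre hab) i with h | h | h
    · exact Or.inl (e.injective (hmem hxφ ((hQ _ (heI a) _ hjB).2 _ h)))
    · exact absurd (hmem hxφ h) (hIBne (heI x) hjB)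
    · exact Or.inr (e.injective (hmem hxφ ((hQ _ (heI b) _ hjB).2 _ h)))
  have hinner : ∀ {a b}, a < b → ∀ i : ℕ, 1 ≤ i → i ≤ col → ∀ x, f (e a) (e b) i ≠ v (e x) := by
    intro a b hab i hi1 hi2 x hx
    have hinj := hfinj _ _ (hpre hab)
    rw [hcol a b hab] at hinj
    rcases hend hab hx with rfl | rfl
    · have := hinj (x₁ := i) (x₂ := 0) (by simp; omega) (by simp)
        (hx.trans (hf0 _ _ (hpre hab)).symm)
      omega
    · have h1 := hf1 _ _ (hpre hab)
      rw [hcol _ _ hab] at h1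
      have := hinj (x₁ := i) (x₂ := col + 1) (by simp; omega) (by simp) (hx.trans h1.symm)
      omega
  refine ⟨col, by omega, v ∘ e, fun a b ↦ f (e a) (e b), ?_, ?_, ?_⟩
  · intro a b hab
    have h1 := hv _ (heI a)
    have h2 := hv _ (heI b)
    rw [show v (e a) = v (e b) from hab] at h1
    exact e.injective (hmem h1 h2)
  · intro a b hab
    have h1 := hf1 _ _ (hpre hab)
    have h2 := hfadj _ _ (hpre hab)
    rw [hcol a b hab] at h1 h2
    exact ⟨hf0 _ _ (hpre hab), h1, h2, hinner hab⟩
  · intro a b a' b' hab hab' i i' hi1 hi2 hi3 hi4 heq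
    have hjB := hJ _ _ (hpre hab)
    have hjB' := hJ _ _ (hpre hab')
    by_cases hJJ : J (e a) (e b) = J (e a') (e b')
    · rw [hJg _ _ (hpre hab) (Finset.mk_mem_product (heI a) (heI b)),
        hJg _ _ (hpre hab') (Finset.mk_mem_product (heI a') (heI b'))] at hJJ
      have h3 := congrArg Subtype.val (g.injective (Subtype.ext hJJ))
      simp only [Prod.mk.injEq, EmbeddingLike.apply_eq_iff_eq] at h3
      obtain ⟨rfl, rfl⟩ := h3
      refine ⟨rfl, rfl, ?_⟩
      have hinj := hfinj _ _ (hpre hab)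
      rw [hcol a b hab] at hinj
      exact hinj (by simp; omega) (by simp; omega) heq
    · exfalso
      have key : ∀ y y', f (e a) (e b) i ∈ Q (e y) (J (e a) (e b)) →
          f (e a) (e b) i ∈ Q (e y') (J (e a') (e b')) → False := by
        intro y y' h h'
        have hyy := hmem ((hQ _ (heI y) _ hjB).2 _ h) ((hQ _ (heI y') _ hjB').2 _ h')
        rw [← hyy] at h'
        exact hinner hab i hi1 hi2 y (hQd _ (heI y) _ hjB _ hjB' hJJ _ h h')
      have hm := hfmem _ _ (hpre hab) i
      have hm' := hfmem _ _ (hpre hab') i'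
      rw [← show f (e a) (e b) i = f (e a') (e b') i' from heq] at hm'
      rcases hm with h | h | h <;> rcases hm' with k | k | k
      · exact key _ _ h k
      · exact hIBne (heI a) hjB' (hmem ((hQ _ (heI a) _ hjB).2 _ h) k)
      · exact key _ _ h k
      · exact hIBne (heI a') hjB (hmem ((hQ _ (heI a') _ hjB').2 _ k) h)
      · exact hJJ (hmem h k)
      · exact hIBne (heI b') hjB (hmem ((hQ _ (heI b') _ hjB').2 _ k) h)
      · exact key _ _ h k
      · exact hIBne (heI b) hjB' (hmem ((hQ _ (heI b) _ hjB).2 _ h) k)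
      · exact key _ _ h k

/-- If `𝒞` is closed under subgraphs and not nowhere dense, then there
is `r` such that `𝒞` contains the `r`-subdivision of every graph. -/
theorem stmt0 (C : Set FGraph)
    (hclosed : ∀ G ∈ C, ∀ H : FGraph, IsSubgraphOf H G → H ∈ C)
    (hnd : ¬ NowhereDense C) :
    ∃ r : ℕ, ∀ (n : ℕ) (H : SimpleGraph (Fin n)),
      ∃ G ∈ C, Nonempty (G.G ≃g Subdivision r H) := by
  classical
  unfold NowhereDense at hnd
  push Not at hnd
  obtain ⟨r, hr⟩ := hnd
  have hclique : ∀ n, ∃ s ≤ 4 * r + 1, ∃ G ∈ C, HasSubdividedClique G.G s n := by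
    intro n
    obtain ⟨m, hm⟩ := exists_hasSubdividedClique_of_isDepthMinor r n
    obtain ⟨G, hG, hmin⟩ := hr m
    obtain ⟨s, hs, h⟩ := hm G.G hmin
    exact ⟨s, hs, G, hG, h⟩
  obtain ⟨s, hs⟩ : ∃ s, ∀ n, ∃ G ∈ C, HasSubdividedClique G.G s n := by
    by_contra! hno
    choose n hn using hno
    obtain ⟨s, hs, G, hG, h⟩ := hclique ((Finset.range (4 * r + 2)).sup n)
    exact hn s G hG (h.mono (Finset.le_sup (Finset.mem_range.2 (by omega))))
  refine ⟨s, fun n H ↦ ?_⟩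
  obtain ⟨G, hG, h⟩ := hs n
  have : Fintype (Fin n ⊕ (H.edgeSet × Fin s)) := Fintype.ofFinite _
  exact ⟨⟨_, Subdivision s H⟩, hclosed G hG _ (h.exists_embedding H), ⟨Iso.refl⟩⟩
end

section
/- A class 𝒞 of graphs is nowhere dense if and only if for every real ε > 0 and every r ∈ ℕ there exists an integer n₀ such that every graph H on n ≥ n₀ vertices that is a depth-r minor of some G ∈ 𝒞 has edge density |E(H)|/|V(H)| at most n^ε. -/
open SimpleGraph

variable {V : Type} {W : Type}

theorem exists_walk_induce_of_le (G : SimpleGraph V) {s t : Set V} (hst : s ⊆ t) {u v : V}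
    (hu : u ∈ s) (hv : v ∈ s) (p : (G.induce s).Walk ⟨u, hu⟩ ⟨v, hv⟩) :
    ∃ q : (G.induce t).Walk ⟨u, hst hu⟩ ⟨v, hst hv⟩, q.length = p.length :=
  ⟨p.map (induceHomOfLE G hst).toHom, p.length_map _⟩

theorem IsDepthMinor.mono {q r : ℕ} (hqr : q ≤ r) {H : SimpleGraph W} {G : SimpleGraph V}
    (h : IsDepthMinor q H G) : IsDepthMinor r H G := by
  obtain ⟨φ, hrad, hdisj, hadj⟩ := h
  refine ⟨φ, fun w => ?_, hdisj, hadj⟩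
  obtain ⟨u, hu⟩ := hrad w
  exact ⟨u, fun v => (hu v).imp fun _ hp => hp.trans hqr⟩

theorem IsDepthMinor.trans {U : Type} {q r : ℕ} {K : SimpleGraph U} {H : SimpleGraph W}
    {G : SimpleGraph V} (hKH : IsDepthMinor q K H) (hHG : IsDepthMinor r H G) :
    IsDepthMinor (q * (2 * r + 1) + r) K G := by
  obtain ⟨ψ, hψr, hψd, hψa⟩ := hKH
  obtain ⟨φ, hφr, hφd, hφa⟩ := hHG
  choose c hc using hφr
  refine ⟨fun k => ⋃ w ∈ ψ k, φ w, fun k => ?_, fun k l hkl => ?_, fun k l hkl => ?_⟩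
  · have hsub : ∀ w ∈ ψ k, φ w ⊆ ⋃ w ∈ ψ k, φ w := fun w hw =>
      Set.subset_biUnion_of_mem (u := φ) hw
    have from_center : ∀ w (hw : w ∈ ψ k) x (hx : x ∈ φ w),
        ∃ p : (G.induce (⋃ w ∈ ψ k, φ w)).Walk ⟨c w, hsub w hw (c w).2⟩ ⟨x, hsub w hw hx⟩,
          p.length ≤ r := by
      intro w hw x hx
      obtain ⟨p, hp⟩ := hc w ⟨x, hx⟩
      obtain ⟨p', hp'⟩ := exists_walk_induce_of_le G (hsub w hw) (c w).2 hx p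
      exact ⟨p', hp'.trans_le hp⟩
    have between : ∀ (w w' : ψ k) (p : (H.induce (ψ k)).Walk w w'),
        ∃ p' : (G.induce (⋃ w ∈ ψ k, φ w)).Walk ⟨c w, hsub w w.2 (c w).2⟩
          ⟨c w', hsub w' w'.2 (c w').2⟩, p'.length ≤ p.length * (2 * r + 1) := by
      intro w w' p
      induction p with
      | nil => exact ⟨Walk.nil, by simp⟩
      | @cons a b d hab p ih =>
        obtain ⟨p₃, hp₃⟩ := ih
        obtain ⟨x, hx, y, hy, hxy⟩ := hφa a b hab
        obtain ⟨p₁, hp₁⟩ := from_center a a.2 x hx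
        obtain ⟨p₂, hp₂⟩ := from_center b b.2 y hy
        have hxy' : (G.induce (⋃ w ∈ ψ k, φ w)).Adj ⟨x, hsub a a.2 hx⟩ ⟨y, hsub b b.2 hy⟩ := hxy
        refine ⟨p₁.append (Walk.cons hxy' (p₂.reverse.append p₃)), ?_⟩
        simp only [Walk.length_append, Walk.length_cons, Walk.length_reverse]
        linarith
    obtain ⟨w₀, hw₀⟩ := hψr k
    refine ⟨⟨c w₀, hsub w₀ w₀.2 (c w₀).2⟩, ?_⟩
    rintro ⟨x, hx⟩
    obtain ⟨w, hw, hxw⟩ := Set.mem_iUnion₂.1 hx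
    obtain ⟨p, hp⟩ := hw₀ ⟨w, hw⟩
    obtain ⟨p₁, hp₁⟩ := between _ _ p
    obtain ⟨p₂, hp₂⟩ := from_center w hw x hxw
    refine ⟨p₁.append p₂, ?_⟩
    rw [Walk.length_append]
    exact add_le_add (hp₁.trans (Nat.mul_le_mul_right _ hp)) hp₂
  · simp only [Set.disjoint_iUnion_left, Set.disjoint_iUnion_right]
    intro w hw w' hw'
    refine hφd fun h => ?_
    subst h
    exact Set.disjoint_left.1 (hψd hkl) ‹_› ‹_›
  · obtain ⟨w, hw, w', hw', hww'⟩ := hψa k l hkl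
    obtain ⟨u, hu, v, hv, huv⟩ := hφa w w' hww'
    exact ⟨u, Set.mem_biUnion hw hu, v, Set.mem_biUnion hw' hv, huv⟩

/-- If every edge of `H` is represented by its own vertex of `B`, adjacent in `G` to both ends of
that edge, then `H` is a depth-`1` minor of `G`. -/
theorem isDepthMinor_one_of_subdivision {G : SimpleGraph V} {H : SimpleGraph W} {ι : W → V}
    (hι : Function.Injective ι) {B : Set V} (hιB : ∀ w, ι w ∉ B) {f : V → V × V}
    (hf : ∀ v ∈ B, G.Adj v (f v).1 ∧ G.Adj v (f v).2)
    (hH : ∀ a b, H.Adj a b → ∃ v ∈ B, s((f v).1, (f v).2) = s(ι a, ι b)) :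
    IsDepthMinor 1 H G := by
  refine ⟨fun w => {v | v = ι w ∨ v ∈ B ∧ (f v).1 = ι w}, fun w => ?_, fun w w' hww' => ?_,
    fun a b hab => ?_⟩
  · refine ⟨⟨ι w, Or.inl rfl⟩, ?_⟩
    rintro ⟨v, rfl | ⟨hv, hvw⟩⟩
    · exact ⟨Walk.nil, by simp⟩
    · have : (G.induce {v | v = ι w ∨ v ∈ B ∧ (f v).1 = ι w}).Adj ⟨ι w, Or.inl rfl⟩
          ⟨v, Or.inr ⟨hv, hvw⟩⟩ := by
        have := (hf v hv).1.symm
        rwa [hvw] at this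
      exact ⟨this.toWalk, by simp⟩
  · refine Set.disjoint_left.2 ?_
    rintro v (rfl | ⟨hv, hvw⟩) (h | ⟨hv', hvw'⟩)
    · exact hww' (hι h)
    · exact hιB _ hv'
    · exact hιB _ (h ▸ hv)
    · exact hww' (hι (hvw.symm.trans hvw'))
  · obtain ⟨v, hv, hvab⟩ := hH a b hab
    rcases Sym2.eq_iff.1 hvab with ⟨h₁, h₂⟩ | ⟨h₁, h₂⟩
    · exact ⟨v, Or.inr ⟨hv, h₁⟩, ι b, Or.inl rfl, h₂ ▸ (hf v hv).2⟩
    · exact ⟨ι a, Or.inl rfl, v, Or.inr ⟨hv, h₁⟩, h₂ ▸ (hf v hv).2.symm⟩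

open Classical in
/-- Either `K_m` is a depth-`1` minor of `G`, or each vertex of `B` can be given its own pair of
neighbours in `A`. -/
theorem isDepthMinor_top_or_exists_injOn_pairs {G : SimpleGraph V} {m : ℕ} {A : Finset V}
    (B : Finset V) (hBA : ∀ v ∈ B, v ∉ A ∧ m ≤ (A.filter (G.Adj v)).card) :
    IsDepthMinor 1 (⊤ : SimpleGraph (Fin m)) G ∨
      ∃ f : V → V × V, Set.InjOn (fun v => s((f v).1, (f v).2)) B ∧
        ∀ v ∈ B, (f v).1 ≠ (f v).2 ∧ ((f v).1 ∈ A ∧ (f v).2 ∈ A) ∧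
          G.Adj v (f v).1 ∧ G.Adj v (f v).2 := by
  induction B using Finset.induction_on with
  | empty => exact Or.inr ⟨fun v => (v, v), by simp, by simp⟩
  | insert v B hv ih =>
    rcases ih fun u hu => hBA u (Finset.mem_insert_of_mem hu) with h | ⟨f, hinj, hf⟩
    · exact Or.inl h
    by_cases hpair : ∃ a b, a ≠ b ∧ (a ∈ A ∧ b ∈ A) ∧ (G.Adj v a ∧ G.Adj v b) ∧
        ∀ u ∈ B, s((f u).1, (f u).2) ≠ s(a, b)
    · obtain ⟨a, b, hab, hA, hadj, hne⟩ := hpair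
      have hupd : ∀ u ∈ B, Function.update f v (a, b) u = f u := fun u hu =>
        Function.update_of_ne (ne_of_mem_of_not_mem hu hv) _ _
      refine Or.inr ⟨Function.update f v (a, b), ?_, ?_⟩
      · rw [Finset.coe_insert, Set.injOn_insert (by simpa using hv)]
        refine ⟨fun x hx y hy hxy => hinj hx hy ?_, ?_⟩
        · simpa only [hupd x hx, hupd y hy] using hxy
        · rintro ⟨u, hu, hux⟩
          simp only [hupd u hu, Function.update_self] at hux
          exact hne u hu hux
      · intro u hu
        rcases Finset.mem_insert.1 hu with rfl | hu
        · simpa only [Function.update_self] using ⟨hab, hA, hadj⟩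
        · rw [hupd u hu]
          exact hf u hu
    · push Not at hpair
      left
      obtain ⟨-, hm⟩ := hBA v (Finset.mem_insert_self _ _)
      obtain ⟨T, hT, hTm⟩ := Finset.exists_subset_card_eq hm
      have hTA : ∀ x ∈ T, x ∈ A ∧ G.Adj v x := fun x hx => Finset.mem_filter.1 (hT hx)
      let e := T.equivFinOfCardEq hTm
      refine isDepthMinor_one_of_subdivision (B := (B : Set V)) (f := f)
        (ι := fun i => (e.symm i : V)) (Subtype.val_injective.comp e.symm.injective)
        (fun i hi => (hBA _ (Finset.mem_insert_of_mem hi)).1 (hTA _ (e.symm i).2).1)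
        (fun u hu => (hf u hu).2.2) fun i j hij => ?_
      exact hpair _ _ (fun h => hij (e.symm.injective (Subtype.val_injective h)))
        ⟨(hTA _ (e.symm i).2).1, (hTA _ (e.symm j).2).1⟩
        ⟨(hTA _ (e.symm i).2).2, (hTA _ (e.symm j).2).2⟩

open Classical in
/-- A graph with more than `D` edges per vertex has a nonempty vertex set inducing a subgraph of
minimum degree at least `D`. -/
theorem exists_nonempty_forall_le_card_filter_adj [Fintype V] (G : SimpleGraph V) {D : ℝ}
    (hD : D * Fintype.card V < G.edgeSet.ncard) :
    ∃ S : Finset V, S.Nonempty ∧ ∀ v ∈ S, D ≤ (S.filter (G.Adj v)).card := by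
  let g : Finset V → ℝ := fun S =>
    (∑ x ∈ S, ((S.filter (G.Adj x)).card : ℝ)) - 2 * D * S.card
  obtain ⟨S, -, hS⟩ := Finset.exists_max_image (Finset.univ : Finset (Finset V)) g ⟨∅, by simp⟩
  refine ⟨S, ?_, fun v hv => ?_⟩
  · by_contra hne
    rw [Finset.not_nonempty_iff_eq_empty] at hne
    have h := hS Finset.univ (Finset.mem_univ _)
    have hsum : ∑ x, (((Finset.univ : Finset V).filter (G.Adj x)).card : ℝ) =
        2 * G.edgeSet.ncard := by
      rw [← coe_edgeFinset, Set.ncard_coe_finset]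
      have := G.sum_degrees_eq_twice_card_edges
      rw [← Nat.cast_ofNat (R := ℝ), ← Nat.cast_mul, ← this, Nat.cast_sum]
      simp [← card_neighborFinset_eq_degree, neighborFinset_eq_filter]
    simp only [g, hne, hsum, Finset.card_univ] at h
    simp at h
    linarith
  · have h := hS (S.erase v) (Finset.mem_univ _)
    have hcard : ((S.erase v).card : ℝ) = S.card - 1 := by
      rw [Finset.card_erase_of_mem hv, Nat.cast_sub (Finset.card_pos.2 ⟨v, hv⟩), Nat.cast_one]
    have hdeg : ∀ x, ((S.filter (G.Adj x)).card : ℝ) =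
        ((S.erase v).filter (G.Adj x)).card + if G.Adj v x then 1 else 0 := by
      intro x
      rw [Finset.filter_erase]
      split_ifs with hx
      · have : v ∈ S.filter (G.Adj x) := Finset.mem_filter.2 ⟨hv, hx.symm⟩
        rw [← Finset.card_erase_add_one this]
        push_cast
        rfl
      · rw [Finset.erase_eq_of_notMem fun h => hx (Finset.mem_filter.1 h).2.symm, add_zero]
    have hsum : ∑ x ∈ S, ((S.filter (G.Adj x)).card : ℝ) =
        ∑ x ∈ S.erase v, (((S.erase v).filter (G.Adj x)).card : ℝ) +
          2 * (S.filter (G.Adj v)).card := by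
      rw [← Finset.add_sum_erase S _ hv, Finset.sum_congr rfl fun x _ => hdeg x,
        Finset.sum_add_distrib, Finset.sum_boole, hdeg v]
      simp only [SimpleGraph.irrefl, if_false]
      ring
    simp only [g, hcard, hsum] at h
    linarith

open Classical in
/-- In a subgraph of minimum degree at least `d`, a set of at most `4 m n / (d - m)` vertices
suffices to provide all but a quarter of the vertices with `m` neighbours each. -/
theorem exists_small_multiply_dominating (G : SimpleGraph V) (S : Finset V) {m : ℕ} {d : ℝ}
    (hmd : (m : ℝ) < d) (hS : ∀ v ∈ S, d ≤ (S.filter (G.Adj v)).card) :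
    ∃ A ⊆ S, (d - m) * A.card ≤ 4 * m * S.card ∧
      4 * (S.filter fun v => (A.filter (G.Adj v)).card < m).card ≤ S.card := by
  let g : Finset V → ℝ := fun A =>
    (∑ v ∈ S, ((min m (A.filter (G.Adj v)).card : ℕ) : ℝ)) - (d - m) / 4 * A.card
  obtain ⟨A, hAS, hA⟩ := Finset.exists_max_image S.powerset g ⟨∅, by simp⟩
  rw [Finset.mem_powerset] at hAS
  refine ⟨A, hAS, ?_, ?_⟩
  · have h := hA ∅ (by simp)
    have hle : ∑ v ∈ S, ((min m (A.filter (G.Adj v)).card : ℕ) : ℝ) ≤ m * S.card := by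
      rw [mul_comm, ← nsmul_eq_mul]
      exact Finset.sum_le_card_nsmul _ _ _ fun v _ => Nat.cast_le.2 (min_le_left _ _)
    simp only [g, Finset.filter_empty, Finset.card_empty] at h
    simp only [Nat.cast_zero, mul_zero, sub_zero, Nat.min_zero, Finset.sum_const_zero] at h
    linarith
  · set U := S.filter fun v => (A.filter (G.Adj v)).card < m with hU
    have hgain : ∀ a ∈ S \ A, ((U.filter fun v => G.Adj v a).card : ℝ) ≤ (d - m) / 4 := by
      intro a ha
      obtain ⟨haS, haA⟩ := Finset.mem_sdiff.1 ha
      have h := hA (insert a A) (Finset.mem_powerset.2 (Finset.insert_subset haS hAS))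
      have hstep : ∀ v ∈ S, ((min m (A.filter (G.Adj v)).card : ℕ) : ℝ) +
          (if (A.filter (G.Adj v)).card < m ∧ G.Adj v a then 1 else 0) ≤
          ((min m ((insert a A).filter (G.Adj v)).card : ℕ) : ℝ) := by
        intro v _
        rw [Finset.filter_insert]
        split_ifs with h₁ h₂ h₂
        · rw [Finset.card_insert_of_notMem fun h => haA (Finset.mem_filter.1 h).1]
          exact_mod_cast (by omega)
        · exact absurd h₁.2 h₂
        · rw [Finset.card_insert_of_notMem fun h => haA (Finset.mem_filter.1 h).1]
          exact_mod_cast (by omega)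
        · simp
      have hsum := Finset.sum_le_sum hstep
      rw [Finset.sum_add_distrib, Finset.sum_boole, ← Finset.filter_filter, ← hU] at hsum
      simp only [g, Finset.card_insert_of_notMem haA, Nat.cast_add, Nat.cast_one] at h
      linarith
    have hcount : ∑ v ∈ U, (((S \ A).filter fun a => G.Adj v a).card : ℝ) =
        ∑ a ∈ S \ A, ((U.filter fun v => G.Adj v a).card : ℝ) := by
      exact_mod_cast Finset.sum_card_bipartiteAbove_eq_sum_card_bipartiteBelow (s := U)
        (t := S \ A) G.Adj
    have hlow : ∀ v ∈ U, d - m ≤ (((S \ A).filter fun a => G.Adj v a).card : ℝ) := by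
      intro v hv
      obtain ⟨hvS, hvm⟩ := Finset.mem_filter.1 hv
      have h₁ := hS v hvS
      have h₂ : (S.filter (G.Adj v)).card ≤
          ((S \ A).filter (G.Adj v)).card + (A.filter (G.Adj v)).card := by
        refine (Finset.card_le_card fun x hx => ?_).trans (Finset.card_union_le _ _)
        by_cases hxA : x ∈ A <;> simp_all
      have h₃ : ((A.filter (G.Adj v)).card : ℝ) ≤ m := Nat.cast_le.2 hvm.le
      have h₄ : ((S.filter (G.Adj v)).card : ℝ) ≤
          ((S \ A).filter (G.Adj v)).card + (A.filter (G.Adj v)).card := by exact_mod_cast h₂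
      linarith
    have hl := Finset.card_nsmul_le_sum U _ _ hlow
    have hr := Finset.sum_le_card_nsmul (S \ A) _ _ hgain
    rw [hcount] at hl
    have hSA : ((S \ A).card : ℝ) ≤ S.card := Nat.cast_le.2 (Finset.card_le_card Finset.sdiff_subset)
    rw [nsmul_eq_mul] at hl hr
    have hpos : 0 < d - m := sub_pos.2 hmd
    have : (d - m) * (4 * U.card) ≤ (d - m) * S.card := by
      have := mul_le_mul_of_nonneg_right hSA (by linarith : 0 ≤ (d - m) / 4)
      linarith
    exact_mod_cast le_of_mul_le_mul_left this hpos

open Classical in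
/-- A subgraph on `n` vertices of minimum degree at least `d ≥ 17 m` yields `K_m` or a graph
with `O(n / d)` vertices and at least `n / 2` edges as a depth-`1` minor. -/
theorem isDepthMinor_top_or_exists_dense_isDepthMinor_one (G : SimpleGraph V) (S : Finset V)
    {m : ℕ} {d : ℝ} (hd : 0 < d) (hmd : 17 * (m : ℝ) ≤ d)
    (hS : ∀ v ∈ S, d ≤ (S.filter (G.Adj v)).card) :
    IsDepthMinor 1 (⊤ : SimpleGraph (Fin m)) G ∨
      ∃ (A : Finset V) (H : SimpleGraph A), IsDepthMinor 1 H G ∧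
        d * A.card ≤ 8 * m * S.card ∧ S.card ≤ 2 * H.edgeSet.ncard := by
  have hm0 : (0 : ℝ) ≤ m := Nat.cast_nonneg _
  obtain ⟨A, hAS, hAcard, hUcard⟩ :=
    exists_small_multiply_dominating G S (m := m) (by linarith) hS
  set U := S.filter fun v => (A.filter (G.Adj v)).card < m with hU
  have hA0 : (0 : ℝ) ≤ A.card := Nat.cast_nonneg _
  have hS0 : (0 : ℝ) ≤ S.card := Nat.cast_nonneg _
  have hAd : d * A.card ≤ 8 * m * S.card := by nlinarith
  have hAquarter : 4 * A.card ≤ S.card := by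
    have : d * (4 * A.card) ≤ d * S.card := by nlinarith
    exact_mod_cast le_of_mul_le_mul_left this hd
  set B := (S \ A) \ U with hB
  have hBcard : S.card ≤ 2 * B.card := by
    have h₁ := Finset.card_sdiff_add_card_eq_card hAS
    have h₂ : (S \ A).card - U.card ≤ B.card := Finset.le_card_sdiff U (S \ A)
    omega
  have hBA : ∀ v ∈ B, v ∉ A ∧ m ≤ (A.filter (G.Adj v)).card := by
    intro v hv
    simp only [hB, hU, Finset.mem_sdiff, Finset.mem_filter, not_and, not_lt] at hv
    exact ⟨hv.1.2, hv.2 hv.1.1⟩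
  rcases isDepthMinor_top_or_exists_injOn_pairs B hBA with h | ⟨f, hinj, hf⟩
  · exact Or.inl h
  let H : SimpleGraph A :=
    (fromEdgeSet ((fun v => s((f v).1, (f v).2)) '' B)).induce (A : Set V)
  refine Or.inr ⟨A, H, ?_, hAd, ?_⟩
  · refine isDepthMinor_one_of_subdivision (ι := Subtype.val) (B := (B : Set V)) (f := f)
      Subtype.val_injective (fun w hw => (hBA _ hw).1 w.2) (fun v hv => (hf v hv).2.2) ?_
    intro a b hab
    exact hab.1
  · have hsub : (fun v => s((f v).1, (f v).2)) '' (B : Set V) ⊆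
        Sym2.map Subtype.val '' H.edgeSet := by
      rintro _ ⟨v, hv, rfl⟩
      obtain ⟨hne, ⟨h₁, h₂⟩, -⟩ := hf v hv
      exact ⟨s(⟨_, h₁⟩, ⟨_, h₂⟩), ⟨⟨v, hv, rfl⟩, hne⟩, rfl⟩
    have h₁ := Set.ncard_le_ncard hsub (Set.toFinite _)
    have h₂ := Set.ncard_image_le (f := Sym2.map Subtype.val) (Set.toFinite H.edgeSet)
    rw [hinj.ncard_image, Set.ncard_coe_finset] at h₁
    omega

theorem ncard_edgeSet_le_sq [Fintype V] (G : SimpleGraph V) :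
    G.edgeSet.ncard ≤ Fintype.card V ^ 2 := by
  classical
  rw [← coe_edgeFinset, Set.ncard_coe_finset]
  exact G.card_edgeFinset_le_card_choose_two.trans (Nat.choose_le_pow _ _)

/-- Every large graph with more than `n ^ (1 + α)` edges contains an arbitrarily large complete
graph as a minor of some fixed depth. -/
def ForcesShallowCliques (α : ℝ) : Prop :=
  ∃ q : ℕ, ∀ m : ℕ, ∃ n₀ : ℕ, ∀ (V : Type) [Fintype V] (G : SimpleGraph V),
    n₀ ≤ Fintype.card V → (Fintype.card V : ℝ) ^ (1 + α) < G.edgeSet.ncard →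
      IsDepthMinor q (⊤ : SimpleGraph (Fin m)) G

theorem forcesShallowCliques_of_one_le {α : ℝ} (hα : 1 ≤ α) : ForcesShallowCliques α := by
  refine ⟨0, fun m => ⟨1, fun V _ G hn hG => absurd hG (not_lt.2 ?_)⟩⟩
  have h₁ : (G.edgeSet.ncard : ℝ) ≤ (Fintype.card V : ℝ) ^ (2 : ℝ) := by
    rw [Real.rpow_two]
    exact_mod_cast ncard_edgeSet_le_sq G
  exact h₁.trans (Real.rpow_le_rpow_of_exponent_le (by exact_mod_cast hn) (by linarith))

theorem ForcesShallowCliques.of_add {ε c α : ℝ} (hε : 0 < ε) (hc : 0 < c) (hcε : 2 * c ≤ ε ^ 2)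
    (hα : ε ≤ α) (h : ForcesShallowCliques (α + c)) : ForcesShallowCliques α := by
  have hα0 : 0 < α := hε.trans_le hα
  obtain ⟨q, hq⟩ := h
  refine ⟨q * (2 * 1 + 1) + 1, fun m => ?_⟩
  obtain ⟨n₁, hn₁⟩ := hq m
  have hlim : Filter.Tendsto (fun N : ℕ => (N : ℝ) ^ α) Filter.atTop Filter.atTop :=
    (tendsto_rpow_atTop hα0).comp tendsto_natCast_atTop_atTop
  have hlim' : Filter.Tendsto (fun N : ℕ => ((N : ℝ) ^ α) ^ c) Filter.atTop Filter.atTop :=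
    (tendsto_rpow_atTop hc).comp hlim
  obtain ⟨n₀, hn₀⟩ := Filter.eventually_atTop.1 <|
    (((hlim.eventually_ge_atTop (17 * (m : ℝ))).and
      (hlim.eventually_ge_atTop (2 * (n₁ : ℝ) ^ 2))).and
      (hlim'.eventually_gt_atTop (2 * (8 * (m : ℝ)) ^ (1 + (α + c))))).and
      (Filter.eventually_ge_atTop 1)
  refine ⟨n₀, fun V _ G hN hG => ?_⟩
  obtain ⟨⟨⟨hNm, hNn₁⟩, hNc⟩, hN1⟩ := hn₀ _ hN
  have hN0 : (0 : ℝ) < Fintype.card V := by exact_mod_cast hN1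
  set d : ℝ := (Fintype.card V : ℝ) ^ α with hd
  have hd0 : 0 < d := Real.rpow_pos_of_pos hN0 _
  classical
  obtain ⟨S, ⟨s, hs⟩, hSdeg⟩ := exists_nonempty_forall_le_card_filter_adj G (D := d) <| by
    rwa [Real.rpow_add hN0, Real.rpow_one, mul_comm] at hG
  set n : ℝ := (S.card : ℝ) with hn
  have hn0 : 0 < n := Nat.cast_pos.2 (Finset.card_pos.2 ⟨s, hs⟩)
  have hdn : d ≤ n := (hSdeg s hs).trans (Nat.cast_le.2 (Finset.card_filter_le _ _))
  have hnd : n ^ α ≤ d :=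
    Real.rpow_le_rpow hn0.le (Nat.cast_le.2 (Finset.card_le_univ S)) hα0.le
  have hn1 : 1 ≤ n := Nat.one_le_cast.2 (Finset.card_pos.2 ⟨s, hs⟩)
  rcases isDepthMinor_top_or_exists_dense_isDepthMinor_one G S hd0 hNm
    (fun v hv => by convert hSdeg v hv) with hK | ⟨A, H, hHG, hA, hH⟩
  · exact hK.mono (by omega)
  have hHn : n ≤ 2 * (H.edgeSet.ncard : ℝ) := by
    rw [hn]
    exact_mod_cast hH
  refine (hn₁ A H ?_ ?_).trans hHG
  · have h₁ : (H.edgeSet.ncard : ℝ) ≤ (Fintype.card A : ℝ) ^ 2 := by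
      exact_mod_cast ncard_edgeSet_le_sq H
    have h₂ : (n₁ : ℝ) ^ 2 ≤ (Fintype.card A : ℝ) ^ 2 := by linarith
    exact_mod_cast (pow_le_pow_iff_left₀ (Nat.cast_nonneg _) (Nat.cast_nonneg _) two_ne_zero).1 h₂
  · rw [Fintype.card_coe]
    have hm8 : (0 : ℝ) ≤ 8 * m := by positivity
    have hA' : (A.card : ℝ) ≤ 8 * m * n ^ (1 - α) := by
      have h₁ : n ^ α * A.card ≤ 8 * m * n :=
        (mul_le_mul_of_nonneg_right hnd (Nat.cast_nonneg _)).trans hA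
      rw [Real.rpow_sub hn0, Real.rpow_one, ← mul_div_assoc,
        le_div_iff₀ (Real.rpow_pos_of_pos hn0 _)]
      linarith
    calc (A.card : ℝ) ^ (1 + (α + c))
        ≤ (8 * m * n ^ (1 - α)) ^ (1 + (α + c)) :=
          Real.rpow_le_rpow (Nat.cast_nonneg _) hA' (by linarith)
      _ = (8 * m) ^ (1 + (α + c)) * n ^ ((1 - α) * (1 + (α + c))) := by
          rw [Real.mul_rpow hm8 (Real.rpow_nonneg hn0.le _), Real.rpow_mul hn0.le]
      _ ≤ (8 * m) ^ (1 + (α + c)) * n ^ (1 - c) := by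
          refine mul_le_mul_of_nonneg_left
            (Real.rpow_le_rpow_of_exponent_le hn1 ?_) (Real.rpow_nonneg hm8 _)
          nlinarith
      _ < n ^ c / 2 * n ^ (1 - c) := by
          refine mul_lt_mul_of_pos_right ?_ (Real.rpow_pos_of_pos hn0 _)
          have := Real.rpow_le_rpow hd0.le hdn hc.le
          linarith
      _ = n / 2 := by
          rw [div_mul_eq_mul_div, ← Real.rpow_add hn0, add_sub_cancel, Real.rpow_one]
      _ ≤ H.edgeSet.ncard := by linarith

theorem forcesShallowCliques {ε : ℝ} (hε : 0 < ε) : ForcesShallowCliques ε := by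
  have hc : 0 < ε ^ 2 / 2 := by positivity
  obtain ⟨k, hk⟩ := exists_nat_gt (1 / (ε ^ 2 / 2))
  rw [div_lt_iff₀ hc] at hk
  have key : ∀ j : ℕ, ForcesShallowCliques (ε + j * (ε ^ 2 / 2)) → ForcesShallowCliques ε := by
    intro j
    induction j with
    | zero => simp
    | succ j ih =>
      intro h
      refine ih (ForcesShallowCliques.of_add hε hc (by linarith)
        (le_add_of_nonneg_right (by positivity)) ?_)
      convert h using 1
      push_cast
      ring
  exact key k (forcesShallowCliques_of_one_le (by linarith))

/-- A class is nowhere dense iff for all `ε > 0` and `r` there is `n₀`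
such that every `n`-vertex depth-`r` minor of a member with `n ≥ n₀` has edge
density at most `n^ε`. -/
theorem stmt1 (C : Set FGraph) :
    NowhereDense C ↔
      ∀ ε : ℝ, 0 < ε → ∀ r : ℕ, ∃ n₀ : ℕ, ∀ n : ℕ, n₀ ≤ n →
        ∀ H : SimpleGraph (Fin n), (∃ G ∈ C, IsDepthMinor r H G.G) →
          (H.edgeSet.ncard : ℝ) / (n : ℝ) ≤ (n : ℝ) ^ ε := by
  constructor
  · intro hC ε hε r
    obtain ⟨q, hq⟩ := forcesShallowCliques hε
    obtain ⟨m, hm⟩ := hC (q * (2 * r + 1) + r)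
    obtain ⟨n₀, hn₀⟩ := hq m
    refine ⟨max n₀ 1, fun n hn H ⟨G, hG, hHG⟩ => ?_⟩
    have hnpos : (0 : ℝ) < n := by exact_mod_cast (le_max_right _ _).trans hn
    by_contra! hlt
    rw [lt_div_iff₀ hnpos] at hlt
    refine hm G hG ((hn₀ (Fin n) H ?_ ?_).trans hHG)
    · simpa using (le_max_left _ _).trans hn
    · rwa [Fintype.card_fin, add_comm, Real.rpow_add hnpos, Real.rpow_one]
  · intro h r
    obtain ⟨n₀, hn₀⟩ := h (1 / 2) (by norm_num) r
    refine ⟨max n₀ 10, fun G hG hK => ?_⟩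
    have hle := hn₀ _ (le_max_left _ _) ⊤ ⟨G, hG, hK⟩
    generalize hn : max n₀ 10 = n at hle
    have hn10 : (10 : ℝ) ≤ n := by exact_mod_cast hn ▸ le_max_right n₀ 10
    rw [← coe_edgeFinset, Set.ncard_coe_finset, card_edgeFinset_top_eq_card_choose_two,
      Fintype.card_fin, Nat.cast_choose_two, ← Real.sqrt_eq_rpow, div_le_iff₀ (by linarith)] at hle
    have hsq := Real.sq_sqrt (by linarith : (0 : ℝ) ≤ n)
    have hs : 3 ≤ √(n : ℝ) := Real.le_sqrt_of_sq_le (by linarith)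
    have hle' : ((n : ℝ) - 1) / 2 ≤ √(n : ℝ) :=
      le_of_mul_le_mul_right (by linarith) (by linarith : (0 : ℝ) < n)
    nlinarith
end

section
/- A class 𝒞 of graphs is nowhere dense if and only if 𝒞 admits balanced neighborhood separators, i.e., for every r ∈ ℕ and every real ε > 0 there exists a number s = s(r,ε) such that for every graph G ∈ 𝒞 and every subset A ⊆ V(G) there exists a set S ⊆ V(G) with |S| ≤ s such that |N_r^{G−S}(v) ∩ A| ≤ ε·|A| for all v ∈ V(G) \ S. -/
open SimpleGraph

variable {V : Type} {W : Type}

/-- Every long list has a long sublist in which the color of a `(k + 1)`-element sublist depends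
only on its head, given Ramsey's theorem for `k`-element sublists. -/
theorem exists_head_homogeneous_sublist {κ : Type} (k : ℕ)
    (ih : ∀ n : ℕ, ∃ N : ℕ, ∀ (f : List ℕ → κ) (L : List ℕ), L.Nodup → N ≤ L.length →
      ∃ M, M.Sublist L ∧ n ≤ M.length ∧ ∀ t t', t.Sublist M → t'.Sublist M →
        t.length = k → t'.length = k → f t = f t') (n : ℕ) :
    ∃ N : ℕ, ∀ (f : List ℕ → κ) (L : List ℕ), L.Nodup → N ≤ L.length →
      ∃ M, M.Sublist L ∧ n ≤ M.length ∧ ∀ x t t', (x :: t).Sublist M → (x :: t').Sublist M →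
        t.length = k → t'.length = k → f (x :: t) = f (x :: t') := by
  induction n with
  | zero =>
    refine ⟨0, fun f L _ _ => ⟨[], by simp, by simp, ?_⟩⟩
    intro x t t' h
    simp at h
  | succ n ihn =>
    obtain ⟨N, hN⟩ := ihn
    obtain ⟨N', hN'⟩ := ih N
    refine ⟨N' + 1, fun f L hL hlen => ?_⟩
    cases L with
    | nil => simp at hlen
    | cons x L =>
      simp only [List.length_cons, Nat.add_le_add_iff_right] at hlen
      rw [List.nodup_cons] at hL
      obtain ⟨M₁, hM₁, hM₁len, hM₁f⟩ := hN' (fun t => f (x :: t)) L hL.2 hlen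
      obtain ⟨M, hM, hMlen, hMf⟩ := hN f M₁ (hM₁.nodup hL.2) hM₁len
      have hx : x ∉ M := fun h => hL.1 ((hM.trans hM₁).subset h)
      refine ⟨x :: M, (hM.trans hM₁).cons_cons x, by simpa using hMlen, ?_⟩
      intro y t t' ht ht' hk hk₂
      by_cases hyx : y = x
      · subst hyx
        rw [List.cons_sublist_cons] at ht ht'
        exact hM₁f t t' (ht.trans hM) (ht'.trans hM) hk hk₂
      · have aux : ∀ s, (y :: s).Sublist (x :: M) → (y :: s).Sublist M := by
          intro s hs
          cases hs with
          | cons _ h => exact h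
          | cons_cons _ h => exact absurd rfl hyx
        exact hMf y t t' (aux t ht) (aux t' ht') hk hk₂

/-- Ramsey's theorem for `k`-element sublists of a list without repetitions. -/
theorem exists_homogeneous_sublist {κ : Type} [Finite κ] (k n : ℕ) :
    ∃ N : ℕ, ∀ (f : List ℕ → κ) (L : List ℕ), L.Nodup → N ≤ L.length →
      ∃ M, M.Sublist L ∧ n ≤ M.length ∧ ∀ t t', t.Sublist M → t'.Sublist M →
        t.length = k → t'.length = k → f t = f t' := by
  classical
  have := Fintype.ofFinite κ
  induction k generalizing n with
  | zero =>
    refine ⟨n, fun f L _ h => ⟨L, List.Sublist.refl L, h, ?_⟩⟩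
    intro t t' _ _ h h'
    rw [List.length_eq_zero_iff.1 h, List.length_eq_zero_iff.1 h']
  | succ k ih =>
    obtain ⟨N, hN⟩ := exists_head_homogeneous_sublist k ih (Fintype.card κ * n)
    refine ⟨N, fun f L hL hlen => ?_⟩
    obtain ⟨M, hM, hMlen, hMf⟩ := hN f L hL hlen
    have hMn := hM.nodup hL
    have hc : ∃ c : ℕ → κ, ∀ x t, (x :: t).Sublist M → t.length = k → f (x :: t) = c x := by
      refine ⟨fun x => if h : ∃ t, (x :: t).Sublist M ∧ t.length = k
        then f (x :: h.choose) else f [], fun x t ht hk => ?_⟩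
      have h : ∃ t, (x :: t).Sublist M ∧ t.length = k := ⟨t, ht, hk⟩
      simp only [h, dif_pos]
      exact hMf x t _ ht h.choose_spec.1 hk h.choose_spec.2
    obtain ⟨c, hc⟩ := hc
    have : Nonempty κ := ⟨f []⟩
    obtain ⟨y, -, hy⟩ := Finset.exists_le_card_fiber_of_mul_le_card_of_maps_to
      (s := M.toFinset) (t := (Finset.univ : Finset κ)) (f := c) (n := n)
      (fun _ _ => Finset.mem_univ _) Finset.univ_nonempty
      (by rwa [List.toFinset_card_of_nodup hMn, Finset.card_univ])
    refine ⟨M.filter (fun x => c x = y), List.filter_sublist.trans hM, ?_, ?_⟩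
    · rw [← List.toFinset_card_of_nodup (hMn.filter _)]
      refine hy.trans (Finset.card_le_card ?_)
      intro x hx
      simpa using hx
    · have aux : ∀ t, t.Sublist (M.filter (fun x => c x = y)) → t.length = k + 1 → f t = y := by
        intro t ht hk
        cases t with
        | nil => simp at hk
        | cons x t =>
          have hx : x ∈ M.filter (fun x => c x = y) := ht.subset (by simp)
          rw [hc x t (ht.trans List.filter_sublist) (by simpa using hk)]
          simpa using (List.mem_filter.1 hx).2
      intro t t' ht ht' hk hk₂
      rw [aux t ht hk, aux t' ht' hk₂]

/-- Ramsey's theorem for sublists with at most `k` elements. -/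
theorem exists_homogeneous_sublist_le {κ : Type} [Finite κ] (k n : ℕ) :
    ∃ N : ℕ, ∀ (f : List ℕ → κ) (L : List ℕ), L.Nodup → N ≤ L.length →
      ∃ M, M.Sublist L ∧ n ≤ M.length ∧ ∀ t t', t.Sublist M → t'.Sublist M →
        t.length = t'.length → t.length ≤ k → f t = f t' := by
  induction k generalizing n with
  | zero =>
    refine ⟨n, fun f L _ h => ⟨L, List.Sublist.refl L, h, ?_⟩⟩
    intro t t' _ _ h h'
    have ht : t = [] := List.length_eq_zero_iff.1 (by omega)
    have ht' : t' = [] := List.length_eq_zero_iff.1 (by omega)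
    rw [ht, ht']
  | succ k ih =>
    obtain ⟨N, hN⟩ := ih n
    obtain ⟨N', hN'⟩ := exists_homogeneous_sublist (κ := κ) (k + 1) N
    refine ⟨N', fun f L hL hlen => ?_⟩
    obtain ⟨M₁, hM₁, hlen₁, hf₁⟩ := hN' f L hL hlen
    obtain ⟨M, hM, hMlen, hf⟩ := hN f M₁ (hM₁.nodup hL) hlen₁
    refine ⟨M, hM.trans hM₁, hMlen, fun t t' ht ht' h hk => ?_⟩
    rcases Nat.lt_or_ge k t.length with hlt | hle
    · exact hf₁ t t' (ht.trans hM) (ht'.trans hM) (by omega) (by omega)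
    · exact hf t t' ht ht' h hle

/-- Ramsey's theorem for increasing lists of length at most `k`. -/
theorem exists_homogeneous_indices {κ : Type} [Finite κ] (k n : ℕ) :
    ∃ N : ℕ, ∀ f : List ℕ → κ, ∃ g : ℕ → ℕ, (∀ i < n, g i < N) ∧
      (∀ i j, i < j → j < n → g i < g j) ∧
      ∀ t t' : List ℕ, t.Sublist (List.range n) → t'.Sublist (List.range n) →
        t.length = t'.length → t.length ≤ k → f (t.map g) = f (t'.map g) := by
  obtain ⟨N, hN⟩ := exists_homogeneous_sublist_le (κ := κ) k n
  refine ⟨N, fun f => ?_⟩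
  obtain ⟨M, hM, hlen, hf⟩ := hN f (List.range N) List.nodup_range (by simp)
  have hg : ((List.range n).map fun i => M.getD i 0).Sublist M := by
    have : (List.range n).map (fun i => M.getD i 0) = M.take n := by
      apply List.ext_getElem
      · simpa using hlen
      · intro i h₁ h₂
        have : i < M.length := by
          simp at h₁
          omega
        simp [this]
    rw [this]
    exact List.take_sublist _ _
  refine ⟨fun i => M.getD i 0, ?_, ?_, ?_⟩
  · intro i hi
    have := (hg.trans hM).subset (List.mem_map_of_mem (List.mem_range.2 hi))
    simpa using this
  · intro i j hij hj
    have h := (List.pairwise_lt_range (n := N)).sublist hM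
    have hj' : j < M.length := by omega
    have hi' : i < M.length := by omega
    simpa [hi', hj'] using List.pairwise_iff_getElem.1 h i j hi' hj' hij
  · intro t t' ht ht' h hk
    exact hf _ _ ((ht.map _).trans hg) ((ht'.map _).trans hg) (by simpa using h) (by simpa using hk)

theorem sublist_range_of_pairwise_lt (n : ℕ) (t : List ℕ) (ht : t.Pairwise (· < ·))
    (hn : ∀ x ∈ t, x < n) : t.Sublist (List.range n) := by
  refine List.sublist_of_subperm_of_pairwise (r := (· < ·)) ?_ ht List.pairwise_lt_range
  exact List.subperm_of_subset (ht.imp (fun h => h.ne)) (fun x hx => List.mem_range.2 (hn x hx))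

/-- Equalities between the values `p c i j` and `p d k l` depend only on the order types of
`(i, k)` and of `(j, l)`, provided `i` and `k` are below `j` and `l`. -/
def OrderInvariant {V : Type} (R n : ℕ) (p : ℕ → ℕ → ℕ → V) : Prop :=
  ∀ c d, c ≤ R → d ≤ R → ∀ i k j l i₁ k₁ j₁ l₁, i < j → i < l → k < j → k < l → j < n → l < n →
    i₁ < j₁ → i₁ < l₁ → k₁ < j₁ → k₁ < l₁ → j₁ < n → l₁ < n →
    (i < k ↔ i₁ < k₁) → (k < i ↔ k₁ < i₁) → (j < l ↔ j₁ < l₁) → (l < j ↔ l₁ < j₁) →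
    p c i j = p d k l → p c i₁ j₁ = p d k₁ l₁

/-- Equality pattern of `p` on the entries of a list. -/
def equalityPattern {V : Type} (R : ℕ) (p : ℕ → ℕ → ℕ → V) (t : List ℕ) :
    Set ((Fin (R + 1) × Fin (R + 1)) × (Fin 4 × Fin 4) × (Fin 4 × Fin 4)) :=
  {x | p x.1.1 (t.getD x.2.1.1 0) (t.getD x.2.1.2 0) =
    p x.1.2 (t.getD x.2.2.1 0) (t.getD x.2.2.2 0)}

theorem exists_orderInvariant (R n : ℕ) : ∃ N : ℕ, ∀ (V : Type) (p : ℕ → ℕ → ℕ → V),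
    ∃ g : ℕ → ℕ, (∀ i < n, g i < N) ∧ (∀ i j, i < j → j < n → g i < g j) ∧
      OrderInvariant R n (fun c i j => p c (g i) (g j)) := by
  obtain ⟨N, hN⟩ := exists_homogeneous_indices
    (κ := Set ((Fin (R + 1) × Fin (R + 1)) × (Fin 4 × Fin 4) × (Fin 4 × Fin 4))) 4 n
  refine ⟨N, fun V p => ?_⟩
  obtain ⟨g, hgN, hg, hf⟩ := hN (equalityPattern R p)
  refine ⟨g, hgN, hg, ?_⟩
  intro c d hc hd i k j l i' k' j' l' hij hil hkj hkl hj hl hij' hil' hkj' hkl' hj' hl' h1 h2 h3 h4 h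
  have key : ∀ (t t' : List ℕ), t.Pairwise (· < ·) → t'.Pairwise (· < ·) →
      (∀ x ∈ t, x < n) → (∀ x ∈ t', x < n) → t.length = t'.length → t.length ≤ 4 →
      ∀ x y z w : Fin 4,
      p c ((t.map g).getD x 0) ((t.map g).getD y 0) =
        p d ((t.map g).getD z 0) ((t.map g).getD w 0) →
      p c ((t'.map g).getD x 0) ((t'.map g).getD y 0) =
        p d ((t'.map g).getD z 0) ((t'.map g).getD w 0) := by
    intro t t' ht ht' hn hn' hlen hlen4 x y z w hxy
    have := hf t t' (sublist_range_of_pairwise_lt n t ht hn)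
      (sublist_range_of_pairwise_lt n t' ht' hn') hlen hlen4
    have hm : ((⟨c, by omega⟩, ⟨d, by omega⟩), (x, y), (z, w)) ∈
        equalityPattern R p (t.map g) := hxy
    rw [this] at hm
    exact hm
  rcases lt_trichotomy i k with hik | hik | hik <;> rcases lt_trichotomy j l with hjl | hjl | hjl
  · exact key [i, k, j, l] [i', k', j', l'] (by simp; omega) (by simp; omega) (by simp; omega)
      (by simp; omega) rfl (by simp) 0 2 1 3 h
  · obtain rfl : j = l := hjl
    obtain rfl : j' = l' := by omega
    exact key [i, k, j] [i', k', j'] (by simp; omega) (by simp; omega) (by simp; omega)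
      (by simp; omega) rfl (by simp) 0 2 1 2 h
  · exact key [i, k, l, j] [i', k', l', j'] (by simp; omega) (by simp; omega) (by simp; omega)
      (by simp; omega) rfl (by simp) 0 3 1 2 h
  · obtain rfl : i = k := hik
    obtain rfl : i' = k' := by omega
    exact key [i, j, l] [i', j', l'] (by simp; omega) (by simp; omega) (by simp; omega)
      (by simp; omega) rfl (by simp) 0 1 0 2 h
  · obtain rfl : i = k := hik
    obtain rfl : i' = k' := by omega
    obtain rfl : j = l := hjl
    obtain rfl : j' = l' := by omega
    exact key [i, j] [i', j'] (by simp; omega) (by simp; omega) (by simp; omega)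
      (by simp; omega) rfl (by simp) 0 1 0 1 h
  · obtain rfl : i = k := hik
    obtain rfl : i' = k' := by omega
    exact key [i, l, j] [i', l', j'] (by simp; omega) (by simp; omega) (by simp; omega)
      (by simp; omega) rfl (by simp) 0 2 0 1 h
  · exact key [k, i, j, l] [k', i', j', l'] (by simp; omega) (by simp; omega) (by simp; omega)
      (by simp; omega) rfl (by simp) 1 2 0 3 h
  · obtain rfl : j = l := hjl
    obtain rfl : j' = l' := by omega
    exact key [k, i, j] [k', i', j'] (by simp; omega) (by simp; omega) (by simp; omega)
      (by simp; omega) rfl (by simp) 1 2 0 2 h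
  · exact key [k, i, l, j] [k', i', l', j'] (by simp; omega) (by simp; omega) (by simp; omega)
      (by simp; omega) rfl (by simp) 1 3 0 2 h

/-- In an order-invariant system without constant positions that starts at a position depending
only on the left index and ends at one depending only on the right index, some interval of
positions runs from a left position to a right position with injective positions in between. -/
theorem OrderInvariant.exists_interval {V : Type} {R n : ℕ} {p : ℕ → ℕ → ℕ → V} (hn : 4 ≤ n)
    (hp : OrderInvariant R n p)
    (hdisj : ∀ c ≤ R, ∀ i j k l, i < j → j < k → k < l → l < n → p c i j ≠ p c k l)
    (hleft : ∀ i j k, i < j → j < k → k < n → p 0 i j = p 0 i k)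
    (hright : ∀ i j k, i < j → j < k → k < n → p R i k = p R j k) :
    ∃ a b, a < b ∧ b ≤ R ∧
      (∀ i j k, i < j → i < k → j < n → k < n → p a i j = p a i k) ∧
      (∀ i j k, i < k → j < k → k < n → p b i k = p b j k) ∧
      (∀ c, a < c → c ≤ b → ∀ i j k, i < j → i < k → j < n → k < n → j ≠ k → p c i j ≠ p c i k) ∧
      (∀ c, a ≤ c → c < b → ∀ i j k, i < k → j < k → k < n → i ≠ j → p c i k ≠ p c j k) := by
  classical
  have hconst : ∀ c ≤ R, p c 0 1 = p c 0 3 → p c 0 3 = p c 2 3 → False := fun c hc h h' =>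
    hdisj c hc 0 1 2 3 (by omega) (by omega) (by omega) (by omega) (h.trans h')
  have hL : ∀ c ≤ R, ∀ i j k, i < j → i < k → j < n → k < n → j ≠ k →
      (p c i j = p c i k ↔ p c 0 1 = p c 0 3) := by
    intro c hc i j k hij hik hj hk hjk
    rcases Nat.lt_or_gt_of_ne hjk with h | h
    · constructor <;> intro heq
      · exact hp c c hc hc i i j k 0 0 1 3 (by omega) (by omega) (by omega) (by omega) (by omega)
          (by omega) (by omega) (by omega) (by omega) (by omega) (by omega) (by omega) (by omega)
          (by omega) (by omega) (by omega) heq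
      · exact hp c c hc hc 0 0 1 3 i i j k (by omega) (by omega) (by omega) (by omega) (by omega)
          (by omega) (by omega) (by omega) (by omega) (by omega) (by omega) (by omega) (by omega)
          (by omega) (by omega) (by omega) heq
    · constructor <;> intro heq
      · exact hp c c hc hc i i k j 0 0 1 3 (by omega) (by omega) (by omega) (by omega) (by omega)
          (by omega) (by omega) (by omega) (by omega) (by omega) (by omega) (by omega) (by omega)
          (by omega) (by omega) (by omega) heq.symm
      · exact (hp c c hc hc 0 0 1 3 i i k j (by omega) (by omega) (by omega) (by omega) (by omega)
          (by omega) (by omega) (by omega) (by omega) (by omega) (by omega) (by omega) (by omega)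
          (by omega) (by omega) (by omega) heq).symm
  have hRt : ∀ c ≤ R, ∀ i j k, i < k → j < k → k < n → i ≠ j →
      (p c i k = p c j k ↔ p c 0 3 = p c 2 3) := by
    intro c hc i j k hik hjk hk hij
    rcases Nat.lt_or_gt_of_ne hij with h | h
    · constructor <;> intro heq
      · exact hp c c hc hc i j k k 0 2 3 3 (by omega) (by omega) (by omega) (by omega) (by omega)
          (by omega) (by omega) (by omega) (by omega) (by omega) (by omega) (by omega) (by omega)
          (by omega) (by omega) (by omega) heq
      · exact hp c c hc hc 0 2 3 3 i j k k (by omega) (by omega) (by omega) (by omega) (by omega)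
          (by omega) (by omega) (by omega) (by omega) (by omega) (by omega) (by omega) (by omega)
          (by omega) (by omega) (by omega) heq
    · constructor <;> intro heq
      · exact hp c c hc hc j i k k 0 2 3 3 (by omega) (by omega) (by omega) (by omega) (by omega)
          (by omega) (by omega) (by omega) (by omega) (by omega) (by omega) (by omega) (by omega)
          (by omega) (by omega) (by omega) heq.symm
      · exact (hp c c hc hc 0 2 3 3 j i k k (by omega) (by omega) (by omega) (by omega) (by omega)
          (by omega) (by omega) (by omega) (by omega) (by omega) (by omega) (by omega) (by omega)
          (by omega) (by omega) (by omega) heq).symm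
  have h0 : p 0 0 1 = p 0 0 3 := hleft 0 1 3 (by omega) (by omega) (by omega)
  have hR : p R 0 3 = p R 2 3 := hright 0 2 3 (by omega) (by omega) (by omega)
  obtain ⟨a, ha⟩ : ∃ a, a = Nat.findGreatest (fun c => p c 0 1 = p c 0 3) R := ⟨_, rfl⟩
  have haR : a ≤ R := ha ▸ Nat.findGreatest_le R
  have haL : p a 0 1 = p a 0 3 := by
    rw [ha]
    exact Nat.findGreatest_spec (P := fun c => p c 0 1 = p c 0 3) (Nat.zero_le R) h0
  have hamax : ∀ c, a < c → c ≤ R → p c 0 1 ≠ p c 0 3 := fun c hc hcR =>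
    Nat.findGreatest_is_greatest (P := fun c => p c 0 1 = p c 0 3) (ha ▸ hc) hcR
  have haR' : a < R := lt_of_le_of_ne haR fun h => hconst R le_rfl (h ▸ haL) hR
  have hex : ∃ b, a < b ∧ p b 0 3 = p b 2 3 := ⟨R, haR', hR⟩
  obtain ⟨hab, hbR⟩ := Nat.find_spec hex
  have hb : Nat.find hex ≤ R := Nat.find_min' hex ⟨haR', hR⟩
  refine ⟨a, Nat.find hex, hab, hb, ?_, ?_, ?_, ?_⟩
  · intro i j k hij hik hj hk
    rcases eq_or_ne j k with rfl | hjk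
    · rfl
    · exact (hL a haR i j k hij hik hj hk hjk).2 haL
  · intro i j k hik hjk hk
    rcases eq_or_ne i j with rfl | hij
    · rfl
    · exact (hRt _ hb i j k hik hjk hk hij).2 hbR
  · intro c hac hcb i j k hij hik hj hk hjk heq
    exact hamax c hac (hcb.trans hb) ((hL c (hcb.trans hb) i j k hij hik hj hk hjk).1 heq)
  · intro c hac hcb i j k hik hjk hk hij heq
    have h := (hRt c (hcb.le.trans hb) i j k hik hjk hk hij).1 heq
    rcases hac.eq_or_lt with rfl | hac
    · exact hconst a haR haL h
    · exact Nat.find_min hex hcb ⟨hac, h⟩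

theorem OrderInvariant.eq_of_eq {V : Type} {R n a b : ℕ} {p : ℕ → ℕ → ℕ → V}
    (hp : OrderInvariant R n p) (hbR : b ≤ R)
    (hinjL : ∀ c, a < c → c ≤ b → ∀ i j k, i < j → i < k → j < n → k < n → j ≠ k →
      p c i j ≠ p c i k)
    (hinjR : ∀ c, a ≤ c → c < b → ∀ i j k, i < k → j < k → k < n → i ≠ j → p c i k ≠ p c j k)
    {c d i j k l : ℕ} (hac : a ≤ c) (hcb : c ≤ b) (had : a ≤ d) (hdb : d ≤ b)
    (hij : i + 1 < j) (hil : i + 1 < l) (hkj : k + 1 < j) (hkl : k + 1 < l)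
    (hj : j + 1 < n) (hl : l + 1 < n)
    (hik : i + 1 ≠ k) (hki : k + 1 ≠ i) (hjl : j + 1 ≠ l) (hlj : l + 1 ≠ j)
    (h : p c i j = p d k l) : (j = l ∨ c = a ∧ d = a) ∧ (i = k ∨ c = b ∧ d = b) := by
  constructor
  · by_contra! hcon
    by_cases hca : c = a
    · have h' := hp c d (by omega) (by omega) i k j l i k j (l + 1) (by omega) (by omega)
        (by omega) (by omega) (by omega) (by omega) (by omega) (by omega) (by omega) (by omega)
        (by omega) (by omega) (by omega) (by omega) (by omega) (by omega) h
      exact hinjL d (lt_of_le_of_ne had (hcon.2 hca).symm) hdb k l (l + 1) (by omega) (by omega)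
        (by omega) (by omega) (by omega) (h.symm.trans h')
    · have h' := hp c d (by omega) (by omega) i k j l i k (j + 1) l (by omega) (by omega)
        (by omega) (by omega) (by omega) (by omega) (by omega) (by omega) (by omega) (by omega)
        (by omega) (by omega) (by omega) (by omega) (by omega) (by omega) h
      exact hinjL c (by omega) hcb i j (j + 1) (by omega) (by omega)
        (by omega) (by omega) (by omega) (h.trans h'.symm)
  · by_contra! hcon
    by_cases hca : c = b
    · have h' := hp c d (by omega) (by omega) i k j l i (k + 1) j l (by omega) (by omega)
        (by omega) (by omega) (by omega) (by omega) (by omega) (by omega) (by omega) (by omega)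
        (by omega) (by omega) (by omega) (by omega) (by omega) (by omega) h
      exact hinjR d had (lt_of_le_of_ne hdb (hcon.2 hca)) k (k + 1) l (by omega) (by omega)
        (by omega) (by omega) (h.symm.trans h')
    · have h' := hp c d (by omega) (by omega) i k j l (i + 1) k j l (by omega) (by omega)
        (by omega) (by omega) (by omega) (by omega) (by omega) (by omega) (by omega) (by omega)
        (by omega) (by omega) (by omega) (by omega) (by omega) (by omega) h
      exact hinjR c hac (by omega) i (i + 1) j (by omega) (by omega)
        (by omega) (by omega) (h.trans h'.symm)

/-- The right index assigned to an unordered pair of numbers below `m`. -/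
def pairIndex (m x y : ℕ) : ℕ := 2 * m + 2 * (min x y * m + max x y)

theorem pairIndex_comm (m x y : ℕ) : pairIndex m x y = pairIndex m y x := by
  simp only [pairIndex, min_comm, max_comm]

theorem pairIndex_lt {m x y : ℕ} (hx : x < m) (hy : y < m) :
    pairIndex m x y + 1 < 2 * m + 2 * (m * m) + 4 := by
  have h : (min x y + 1) * m ≤ m * m := Nat.mul_le_mul_right m (by omega)
  have h' : max x y < m := by omega
  rw [Nat.add_mul] at h
  unfold pairIndex
  omega

theorem pairIndex_inj_left {m x y x' y' : ℕ} (hxy : x < y) (hy : y < m) (hxy' : x' < y')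
    (hy' : y' < m) (h : pairIndex m x y = pairIndex m x' y') : x = x' := by
  unfold pairIndex at h
  rw [min_eq_left hxy.le, min_eq_left hxy'.le, max_eq_right hxy.le, max_eq_right hxy'.le] at h
  have heq : x * m + y = x' * m + y' := by omega
  have hm : 0 < m := by omega
  have h1 : (x * m + y) / m = x := by
    rw [Nat.add_comm, Nat.add_mul_div_right _ _ hm, Nat.div_eq_of_lt hy, Nat.zero_add]
  have h2 : (x' * m + y') / m = x' := by
    rw [Nat.add_comm, Nat.add_mul_div_right _ _ hm, Nat.div_eq_of_lt hy', Nat.zero_add]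
  rw [← h1, ← h2, heq]

/-- An order-invariant system of paths contains a complete graph as a shallow minor. -/
theorem OrderInvariant.isDepthMinor_top {V : Type} {G : SimpleGraph V} {R m n : ℕ}
    {p : ℕ → ℕ → ℕ → V} (hn : n = 2 * m + 2 * (m * m) + 4) (hp : OrderInvariant R n p)
    (hadj : ∀ c < R, ∀ i j, i < j → j < n →
      p c i j = p (c + 1) i j ∨ G.Adj (p c i j) (p (c + 1) i j))
    (hdisj : ∀ c ≤ R, ∀ i j k l, i < j → j < k → k < l → l < n → p c i j ≠ p c k l)
    (hleft : ∀ i j k, i < j → j < k → k < n → p 0 i j = p 0 i k)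
    (hright : ∀ i j k, i < j → j < k → k < n → p R i k = p R j k) :
    IsDepthMinor R (⊤ : SimpleGraph (Fin m)) G := by
  obtain ⟨a, b, hab, hbR, hA, hB, hinjL, hinjR⟩ :=
    hp.exists_interval (by omega) hdisj hleft hright
  have hlow : ∀ (x : Fin m) (y z : Fin m), 2 * (x : ℕ) + 1 < pairIndex m y z := by
    intro x y z
    unfold pairIndex
    omega
  have hup : ∀ (x y : Fin m), pairIndex m x y + 1 < n := fun x y => hn ▸ pairIndex_lt x.2 y.2
  have heven : ∀ (x y z w : ℕ), pairIndex m x y + 1 ≠ pairIndex m z w := by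
    intro x y z w
    unfold pairIndex
    omega
  refine ⟨fun x => {v | ∃ (y : Fin m) (c : ℕ), a ≤ c ∧ (c < b ∨ c = b ∧ x < y) ∧
    v = p c (2 * x) (pairIndex m x y)}, ?_, ?_, ?_⟩
  · intro x
    refine ⟨⟨p a (2 * x) (pairIndex m x x), x, a, le_rfl, Or.inl hab, rfl⟩, ?_⟩
    rintro ⟨v, y, c, hac, hc, rfl⟩
    suffices H : ∃ q : (G.induce {v | ∃ (y : Fin m) (c : ℕ), a ≤ c ∧ (c < b ∨ c = b ∧ x < y) ∧
        v = p c (2 * x) (pairIndex m x y)}).Walk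
        ⟨p a (2 * x) (pairIndex m x x), x, a, le_rfl, Or.inl hab, rfl⟩
        ⟨p c (2 * x) (pairIndex m x y), y, c, hac, hc, rfl⟩, q.length ≤ c - a by
      obtain ⟨q, hq⟩ := H
      exact ⟨q, by omega⟩
    induction c, hac using Nat.le_induction with
    | base =>
      have h : p a (2 * x) (pairIndex m x x) = p a (2 * x) (pairIndex m x y) :=
        hA _ _ _ (by have := hlow x x x; omega) (by have := hlow x x y; omega)
          (by have := hup x x; omega) (by have := hup x y; omega)
      exact ⟨Walk.nil.copy rfl (Subtype.ext h), by simp⟩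
    | succ c hac ih =>
      obtain ⟨q, hq⟩ := ih (Or.inl (by omega))
      rcases hadj c (by omega) (2 * x) (pairIndex m x y) (by have := hlow x x y; omega)
        (by have := hup x y; omega) with h | h
      · exact ⟨q.copy rfl (Subtype.ext h), by simp; omega⟩
      · exact ⟨q.concat (by simpa using h), by simp; omega⟩
  · intro x x' hx
    rw [Set.disjoint_left]
    rintro v ⟨y, c, hac, hc, rfl⟩ ⟨y', d, had, hd, h⟩
    have hx' : (x : ℕ) ≠ x' := fun h => hx (Fin.ext h)
    have := hp.eq_of_eq hbR hinjL hinjR hac (by omega) had (by omega) (hlow x x y) (hlow x x' y')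
      (hlow x' x y) (hlow x' x' y') (hup x y) (hup x' y') (by omega) (by omega) (heven _ _ _ _)
      (heven _ _ _ _) h
    have hcb : c = b ∧ d = b := this.2.resolve_left (by omega)
    have hj : pairIndex m x y = pairIndex m x' y' := this.1.resolve_right (by omega)
    have hxy : x < y := by omega
    have hxy' : x' < y' := by omega
    exact hx' (pairIndex_inj_left hxy y.2 hxy' y'.2 hj)
  · have main : ∀ x y : Fin m, x < y →
        G.Adj (p (b - 1) (2 * y) (pairIndex m y x)) (p b (2 * x) (pairIndex m x y)) := by
      intro x y hxy
      have hBxy : p b (2 * x) (pairIndex m x y) = p b (2 * y) (pairIndex m y x) := by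
        rw [pairIndex_comm m y x]
        exact hB _ _ _ (by have := hlow x x y; omega) (by have := hlow y x y; omega)
          (by have := hup x y; omega)
      have hl := hlow y y x
      have hu := hup y x
      rw [hBxy]
      have := hadj (b - 1) (by omega) (2 * y) (pairIndex m y x) (by omega) (by omega)
      rw [Nat.sub_add_cancel (by omega)] at this
      refine this.resolve_left fun heq => ?_
      have h' := hp (b - 1) b (by omega) hbR (2 * y) (2 * y) _ _ (2 * y + 1) (2 * y + 1)
        (pairIndex m y x) (pairIndex m y x) (by omega) (by omega)
        (by omega) (by omega) (by omega) (by omega) (by omega) (by omega) (by omega) (by omega)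
        (by omega) (by omega) (by omega) (by omega) (by omega) (by omega) heq
      refine hinjR (b - 1) (by omega) (by omega) (2 * y) (2 * y + 1) (pairIndex m y x) (by omega)
        (by omega) (by omega) (by omega) ?_
      rw [heq, h']
      exact hB _ _ _ (by omega) (by omega) (by omega)
    intro x y hxy
    rcases lt_or_gt_of_ne (show x ≠ y from hxy) with h | h
    · exact ⟨_, ⟨y, b, hab.le, Or.inr ⟨rfl, h⟩, rfl⟩, _, ⟨x, b - 1, by omega, Or.inl (by omega), rfl⟩,
        (main x y h).symm⟩
    · exact ⟨_, ⟨y, b - 1, by omega, Or.inl (by omega), rfl⟩, _, ⟨x, b, hab.le, Or.inr ⟨rfl, h⟩, rfl⟩,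
        main y x h⟩

/-- `q` is a walk from `u` to `w` inside `X` which may pause and has arrived after `R` steps. -/
def IsLazyWalk {V : Type} (G : SimpleGraph V) (X : Set V) (R : ℕ) (u w : V) (q : ℕ → V) : Prop :=
  q 0 = u ∧ q R = w ∧ (∀ c, q c ∈ X) ∧ ∀ c, q c = q (c + 1) ∨ G.Adj (q c) (q (c + 1))

theorem IsLazyWalk.mono {V : Type} {G : SimpleGraph V} {X Y : Set V} {R : ℕ} {u w : V} {q : ℕ → V}
    (h : IsLazyWalk G X R u w q) (hXY : X ⊆ Y) : IsLazyWalk G Y R u w q :=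
  ⟨h.1, h.2.1, fun c => hXY (h.2.2.1 c), h.2.2.2⟩

theorem exists_isLazyWalk {V : Type} {G : SimpleGraph V} {X : Set V} {R : ℕ} {u w : V}
    (h : w ∈ ballAvoiding G Xᶜ R u) : ∃ q, IsLazyWalk G X R u w q := by
  obtain ⟨p, hp, hX⟩ := h
  refine ⟨p.getVert, p.getVert_zero, p.getVert_of_length_le hp, ?_, ?_⟩
  · intro c
    simpa using hX _ (p.getVert_mem_support c)
  · intro c
    rcases Nat.lt_or_ge c p.length with hc | hc
    · exact Or.inr (p.adj_getVert_succ hc)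
    · left
      rw [p.getVert_of_length_le hc, p.getVert_of_length_le (by omega)]

theorem ballAvoiding_subset_compl {V : Type} (G : SimpleGraph V) (S : Set V) (r : ℕ) (v : V) :
    ballAvoiding G S r v ⊆ Sᶜ := by
  rintro u ⟨p, -, hp⟩
  exact hp u p.end_mem_support

theorem notMem_of_mem_ballAvoiding {V : Type} {G : SimpleGraph V} {S : Set V} {r : ℕ} {u v : V}
    (h : u ∈ ballAvoiding G S r v) : v ∉ S := by
  obtain ⟨p, -, hp⟩ := h
  exact hp v p.start_mem_support

theorem ballAvoiding_anti {V : Type} (G : SimpleGraph V) {S T : Set V} (hST : S ⊆ T) (r : ℕ)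
    (v : V) : ballAvoiding G T r v ⊆ ballAvoiding G S r v := by
  rintro u ⟨p, hl, hp⟩
  exact ⟨p, hl, fun x hx hxS => hp x hx (hST hxS)⟩

theorem mem_ballAvoiding_comm {V : Type} {G : SimpleGraph V} {S : Set V} {r : ℕ} {u v : V}
    (h : u ∈ ballAvoiding G S r v) : v ∈ ballAvoiding G S r u := by
  obtain ⟨p, hl, hp⟩ := h
  exact ⟨p.reverse, by simpa using hl, by simpa using hp⟩

theorem mem_ballAvoiding_trans {V : Type} {G : SimpleGraph V} {S : Set V} {r s : ℕ} {u v w : V}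
    (h : u ∈ ballAvoiding G S r v) (h' : w ∈ ballAvoiding G S s u) :
    w ∈ ballAvoiding G S (r + s) v := by
  obtain ⟨p, hl, hp⟩ := h
  obtain ⟨q, hl', hq⟩ := h'
  refine ⟨p.append q, by simp; omega, fun x hx => ?_⟩
  rcases (Walk.mem_support_append_iff p q).1 hx with hx | hx
  · exact hp x hx
  · exact hq x hx

theorem mem_ballAvoiding_of_mem_support {V : Type} {G : SimpleGraph V} {S : Set V} {r : ℕ}
    {u v x : V} (p : G.Walk v u) (hl : p.length ≤ r) (hp : ∀ x ∈ p.support, x ∉ S)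
    (hx : x ∈ p.support) : x ∈ ballAvoiding G S r v := by
  classical
  exact ⟨p.takeUntil x hx, (p.length_takeUntil_le_length hx).trans hl,
    fun y hy => hp y (p.support_takeUntil_subset_support hx hy)⟩

/-- The vertices on the walks to `v` recorded in the history `h`. -/
def recordedPaths {V : Type} (R : ℕ) (h : List (V × (V → ℕ → V))) (v : V) : List V :=
  h.flatMap fun e => (List.range (R + 1)).map (e.2 v)

theorem length_recordedPaths {V : Type} (R : ℕ) (h : List (V × (V → ℕ → V))) (v : V) :
    (recordedPaths R h v).length = h.length * (R + 1) := by
  simp [recordedPaths, List.length_flatMap]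

theorem ncard_recordedPaths_le {V : Type} (R : ℕ) (h : List (V × (V → ℕ → V))) (v : V) :
    {u | u ∈ recordedPaths R h v}.ncard ≤ h.length * (R + 1) := by
  classical
  rw [← length_recordedPaths R h v, ← List.coe_toFinset, Set.ncard_coe_finset]
  exact List.toFinset_card_le _

/-- The arena after a move to `v`: the `R`-ball around `v` without the recorded paths to `v`. -/
def nextArena {V : Type} (G : SimpleGraph V) (R : ℕ) (h : List (V × (V → ℕ → V))) (X : Set V)
    (v : V) : Set V :=
  ballAvoiding G Xᶜ R v \ {u | u ∈ recordedPaths R h v}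

/-- A legal continuation of the splitter game with history `h` in the arena `X`, in which splitter
always deletes the recorded paths to the vertex just chosen. Each move records a vertex along with
walks from it to all vertices of the next arena. -/
def IsPlay {V : Type} (G : SimpleGraph V) (R : ℕ) :
    List (V × (V → ℕ → V)) → Set V → List (V × (V → ℕ → V)) → Prop
  | _, _, [] => True
  | h, X, e :: t => e.1 ∈ X ∧
      (∀ w ∈ nextArena G R h X e.1, IsLazyWalk G X R e.1 w (e.2 w)) ∧
      IsPlay G R (e :: h) (nextArena G R h X e.1) t

theorem nextArena_subset {V : Type} (G : SimpleGraph V) (R : ℕ) (h : List (V × (V → ℕ → V)))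
    (X : Set V) (v : V) : nextArena G R h X v ⊆ X := fun u hu => by
  simpa using ballAvoiding_subset_compl G Xᶜ R v hu.1

theorem IsPlay.fst_mem {V : Type} {G : SimpleGraph V} {R : ℕ} {h t : List (V × (V → ℕ → V))}
    {X : Set V} (ht : IsPlay G R h X t) : ∀ e ∈ t, e.1 ∈ X := by
  induction t generalizing h X with
  | nil => simp
  | cons e t ih =>
    obtain ⟨he, -, ht⟩ := ht
    intro f hf
    rcases List.mem_cons.1 hf with rfl | hf
    · exact he
    · exact nextArena_subset G R h X e.1 (ih ht f hf)

theorem IsPlay.isLazyWalk {V : Type} {G : SimpleGraph V} {R : ℕ} {h t : List (V × (V → ℕ → V))}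
    {X : Set V} (ht : IsPlay G R h X t) {e f : V × (V → ℕ → V)} (hef : [e, f].Sublist t) :
    IsLazyWalk G X R e.1 f.1 (e.2 f.1) := by
  induction t generalizing h X with
  | nil => simp at hef
  | cons e' t ih =>
    obtain ⟨-, hw, ht⟩ := ht
    cases hef with
    | cons _ hef => exact (ih ht hef).mono (nextArena_subset G R h X e'.1)
    | cons_cons _ hef => exact hw _ (ht.fst_mem f (hef.subset (by simp)))

theorem IsPlay.ne_of_mem_history {V : Type} {G : SimpleGraph V} {R : ℕ}
    {h t : List (V × (V → ℕ → V))} {X : Set V} (ht : IsPlay G R h X t)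
    {e f f' e' : V × (V → ℕ → V)} (he : e ∈ h) (hsub : [f, e', f'].Sublist t) {c : ℕ}
    (hc : c ≤ R) : e.2 f.1 c ≠ e'.2 f'.1 c := by
  induction t generalizing h X with
  | nil => simp at hsub
  | cons a t ih =>
    obtain ⟨-, hw, ht⟩ := ht
    cases hsub with
    | cons _ hsub => exact ih ht (List.mem_cons_of_mem _ he) hsub
    | cons_cons _ hsub =>
      intro heq
      refine ((ht.isLazyWalk hsub).2.2.1 c).2 ?_
      rw [← heq]
      exact List.mem_flatMap.2 ⟨e, he, List.mem_map.2 ⟨c, List.mem_range.2 (by omega), rfl⟩⟩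

theorem IsPlay.ne {V : Type} {G : SimpleGraph V} {R : ℕ}
    {h t : List (V × (V → ℕ → V))} {X : Set V} (ht : IsPlay G R h X t)
    {e f f' e' : V × (V → ℕ → V)} (hsub : [e, f, e', f'].Sublist t) {c : ℕ}
    (hc : c ≤ R) : e.2 f.1 c ≠ e'.2 f'.1 c := by
  induction t generalizing h X with
  | nil => simp at hsub
  | cons a t ih =>
    obtain ⟨-, hw, ht⟩ := ht
    cases hsub with
    | cons _ hsub => exact ih ht hsub
    | cons_cons _ hsub => exact ht.ne_of_mem_history (List.mem_cons_self) hsub hc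

/-- In a family of subsets of a finite type, boundedly many nonempty members meet every member that
contains a proportion of more than `ε` of `A`. -/
theorem exists_finset_hitting {V : Type} [Finite V] (A : Set V) (B : V → Set V) (ε : ℝ)
    (hε : 0 < ε) (hA : 0 < A.ncard) :
    ∃ F : Finset V, F.card ≤ ⌈1 / ε⌉₊ ∧ (∀ v ∈ F, (B v).Nonempty) ∧
      ∀ u, ε * A.ncard < (B u ∩ A).ncard → ∃ v ∈ F, (B u ∩ B v).Nonempty := by
  classical
  have hpos : (0 : ℝ) < A.ncard := by exact_mod_cast hA
  have hne : ∀ u, ε * A.ncard < (B u ∩ A).ncard → (B u).Nonempty := by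
    intro u hu
    have h : (0 : ℝ) < (B u ∩ A).ncard := (mul_pos hε hpos).trans hu
    have h' : 0 < (B u ∩ A).ncard := by exact_mod_cast h
    exact ((Set.ncard_pos (Set.toFinite _)).1 h').mono Set.inter_subset_left
  have hfin : {F : Finset V | (∀ v ∈ F, ε * A.ncard < (B v ∩ A).ncard) ∧
      (F : Set V).PairwiseDisjoint fun v => B v ∩ A}.Finite := Set.toFinite _
  obtain ⟨F, hF⟩ := hfin.exists_maximal ⟨∅, by simp⟩
  obtain ⟨hheavy, hdisj⟩ := hF.prop
  refine ⟨F, ?_, fun v hv => hne v (hheavy v hv), ?_⟩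
  · have h1 : (F.card : ℝ) * (ε * A.ncard) ≤ A.ncard := by
      have hsum : ∑ v ∈ F, (B v ∩ A).ncard ≤ A.ncard := by
        rw [← finsum_mem_coe_finset, ← F.finite_toSet.ncard_biUnion (fun _ _ => Set.toFinite _) hdisj]
        exact Set.ncard_le_ncard (Set.iUnion₂_subset fun _ _ => Set.inter_subset_right)
      calc (F.card : ℝ) * (ε * A.ncard) = ∑ v ∈ F, ε * (A.ncard : ℝ) := by simp
        _ ≤ ∑ v ∈ F, ((B v ∩ A).ncard : ℝ) := Finset.sum_le_sum fun v hv => (hheavy v hv).le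
        _ ≤ A.ncard := by exact_mod_cast hsum
    have h2 : (F.card : ℝ) ≤ 1 / ε := by
      rw [le_div_iff₀ hε]
      nlinarith
    exact_mod_cast h2.trans (Nat.le_ceil _)
  · intro u hu
    by_contra! hcon
    have huF : u ∉ F := fun h => by
      have := hcon u h
      rw [Set.inter_self] at this
      exact (hne u hu).ne_empty this
    have hins : insert u F ≤ F := by
      refine hF.le_of_ge ⟨?_, ?_⟩ (Finset.subset_insert u F)
      · intro v hv
        rcases Finset.mem_insert.1 hv with rfl | hv
        · exact hu
        · exact hheavy v hv
      · rw [Finset.coe_insert, Set.pairwiseDisjoint_insert_of_notMem (by simpa using huF)]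
        refine ⟨hdisj, fun v hv => ?_⟩
        rw [Set.disjoint_iff_inter_eq_empty, ← Set.subset_empty_iff, ← hcon v hv]
        exact Set.inter_subset_inter Set.inter_subset_left Set.inter_subset_left
    exact huF (hins (Finset.mem_insert_self u F))

/-- Either a small set of vertices separates the arena, or the game can be played for `n` more
moves. -/
theorem exists_separator_or_isPlay (r : ℕ) (ε : ℝ) (hε : 0 < ε) (n k : ℕ) :
    ∃ s : ℕ, ∀ (V : Type) [Finite V] (G : SimpleGraph V) (A : Set V)
      (h : List (V × (V → ℕ → V))) (X : Set V), h.length ≤ k →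
      (∃ S : Set V, S.ncard ≤ s ∧
        ∀ v, ((ballAvoiding G (Xᶜ ∪ S) r v ∩ A).ncard : ℝ) ≤ ε * (A.ncard : ℝ)) ∨
      ∃ t, t.length = n ∧ IsPlay G (3 * r) h X t := by
  induction n generalizing k with
  | zero => exact ⟨0, fun V _ G A h X _ => Or.inr ⟨[], rfl, trivial⟩⟩
  | succ n ih =>
    obtain ⟨s, hs⟩ := ih (k + 1)
    refine ⟨⌈1 / ε⌉₊ * (s + k * (3 * r + 1)), fun V _ G A h X hk => ?_⟩
    rcases Nat.eq_zero_or_pos A.ncard with hA | hA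
    · left
      refine ⟨∅, by simp, fun v => ?_⟩
      have : (ballAvoiding G (Xᶜ ∪ ∅) r v ∩ A).ncard ≤ A.ncard :=
        Set.ncard_le_ncard Set.inter_subset_right
      have h0 : (ballAvoiding G (Xᶜ ∪ ∅) r v ∩ A).ncard = 0 := by omega
      rw [h0, hA]
      simp
    obtain ⟨F, hFcard, hFne, hF⟩ := exists_finset_hitting A (ballAvoiding G Xᶜ r) ε hε hA
    by_cases hplay : ∃ v ∈ F, ∃ q : V → ℕ → V,
        (∀ w ∈ nextArena G (3 * r) h X v, IsLazyWalk G X (3 * r) v w (q w)) ∧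
        ∃ t, t.length = n ∧ IsPlay G (3 * r) ((v, q) :: h) (nextArena G (3 * r) h X v) t
    · right
      obtain ⟨v, hv, q, hq, t, htn, ht⟩ := hplay
      refine ⟨(v, q) :: t, by simp [htn], ?_, hq, ht⟩
      obtain ⟨u, hu⟩ := hFne v hv
      simpa using notMem_of_mem_ballAvoiding hu
    · left
      have hsep : ∀ v ∈ F, ∃ S : Set V, S.ncard ≤ s ∧ ∀ u,
          ((ballAvoiding G ((nextArena G (3 * r) h X v)ᶜ ∪ S) r u ∩ A).ncard : ℝ) ≤
            ε * (A.ncard : ℝ) := by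
        intro v hv
        have hex : ∀ w, ∃ q, w ∈ nextArena G (3 * r) h X v → IsLazyWalk G X (3 * r) v w q := by
          intro w
          by_cases hw : w ∈ nextArena G (3 * r) h X v
          · obtain ⟨q, hq⟩ := exists_isLazyWalk hw.1
            exact ⟨q, fun _ => hq⟩
          · exact ⟨fun _ => v, fun h => absurd h hw⟩
        choose q hq using hex
        rcases hs V G A ((v, q) :: h) (nextArena G (3 * r) h X v) (by simpa using hk) with h' | h'
        · exact h'
        · exact absurd ⟨v, hv, q, hq, h'⟩ hplay
      choose! S hScard hS using hsep
      refine ⟨⋃ v ∈ F, (S v ∪ {u | u ∈ recordedPaths (3 * r) h v}), ?_, ?_⟩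
      · refine (Finset.set_ncard_biUnion_le _ _).trans ?_
        refine (Finset.sum_le_card_nsmul F _ (s + k * (3 * r + 1)) fun v hv => ?_).trans ?_
        · refine (Set.ncard_union_le _ _).trans (Nat.add_le_add (hScard v hv) ?_)
          exact (ncard_recordedPaths_le _ _ _).trans (Nat.mul_le_mul_right _ hk)
        · rw [smul_eq_mul]
          exact Nat.mul_le_mul_right _ hFcard
      · intro u
        by_contra! hu
        have hsub : ballAvoiding G (Xᶜ ∪ ⋃ v ∈ F, (S v ∪ {u | u ∈ recordedPaths (3 * r) h v})) r u ⊆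
            ballAvoiding G Xᶜ r u := ballAvoiding_anti G Set.subset_union_left r u
        obtain ⟨v, hv, w, hwu, hwv⟩ := hF u (hu.trans_le (by
          exact_mod_cast Set.ncard_le_ncard (Set.inter_subset_inter_left A hsub)))
        have huv : u ∈ ballAvoiding G Xᶜ (r + r) v :=
          mem_ballAvoiding_trans hwv (mem_ballAvoiding_comm hwu)
        have hsub' :
            ballAvoiding G (Xᶜ ∪ ⋃ v ∈ F, (S v ∪ {u | u ∈ recordedPaths (3 * r) h v})) r u ⊆
            ballAvoiding G ((nextArena G (3 * r) h X v)ᶜ ∪ S v) r u := by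
          rintro y ⟨p, hl, hp⟩
          refine ⟨p, hl, fun x hx => ?_⟩
          have hpx : x ∉ S v ∪ {u | u ∈ recordedPaths (3 * r) h v} := fun h' =>
            hp x hx (Or.inr (Set.mem_biUnion hv h'))
          have hxv : x ∈ ballAvoiding G Xᶜ (r + r + r) v :=
            mem_ballAvoiding_trans huv (mem_ballAvoiding_of_mem_support p hl
              (fun z hz hzX => hp z hz (Or.inl hzX)) hx)
          rw [show r + r + r = 3 * r by ring] at hxv
          rintro (h' | h')
          · exact h' ⟨hxv, fun h'' => hpx (Or.inr h'')⟩
          · exact hpx (Or.inl h')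
        have hle : ((ballAvoiding G (Xᶜ ∪ ⋃ v ∈ F,
            (S v ∪ {u | u ∈ recordedPaths (3 * r) h v})) r u ∩ A).ncard : ℝ) ≤
            (ballAvoiding G ((nextArena G (3 * r) h X v)ᶜ ∪ S v) r u ∩ A).ncard := by
          exact_mod_cast Set.ncard_le_ncard (Set.inter_subset_inter_left A hsub')
        exact absurd (hu.trans_le (hle.trans (hS v hv u))) (lt_irrefl _)

/-- Long plays contain a large complete graph as a shallow minor. -/
theorem exists_isDepthMinor_top_of_isPlay (R m : ℕ) : ∃ N : ℕ, ∀ (V : Type) (G : SimpleGraph V)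
    (t : List (V × (V → ℕ → V))), t.length = N → IsPlay G R [] Set.univ t →
    IsDepthMinor R (⊤ : SimpleGraph (Fin m)) G := by
  obtain ⟨n, hn⟩ : ∃ n, n = 2 * m + 2 * (m * m) + 4 := ⟨_, rfl⟩
  obtain ⟨N, hN⟩ := exists_orderInvariant R n
  refine ⟨N, fun V G t htN ht => ?_⟩
  have hpos : 0 < N := by
    obtain ⟨g, hg, -⟩ := hN Unit (fun _ _ _ => ())
    exact (Nat.zero_le _).trans_lt (hg 0 (by omega))
  obtain ⟨e, he⟩ : ∃ e, e ∈ t := List.exists_mem_of_length_pos (htN ▸ hpos)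
  obtain ⟨g, hgN, hg, hinv⟩ := hN V fun c i j => (t.getD i e).2 (t.getD j e).1 c
  have hmap : (List.range N).map (fun i => t.getD i e) = t := by
    apply List.ext_getElem
    · simpa using htN.symm
    · intro i h₁ h₂
      simp [h₂]
  have hsub : ∀ l : List ℕ, l.Pairwise (· < ·) → (∀ x ∈ l, x < N) →
      (l.map fun i => t.getD i e).Sublist t := by
    intro l hl hlN
    have := (sublist_range_of_pairwise_lt N l hl hlN).map (fun i => t.getD i e)
    rwa [hmap] at this
  have hlazy : ∀ i j, i < j → j < n → IsLazyWalk G Set.univ R (t.getD (g i) e).1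
      (t.getD (g j) e).1 ((t.getD (g i) e).2 (t.getD (g j) e).1) := by
    intro i j hij hj
    exact ht.isLazyWalk (hsub [g i, g j] (by simpa using hg i j hij hj)
      (by simp [hgN i (by omega), hgN j hj]))
  refine hinv.isDepthMinor_top hn ?_ ?_ ?_ ?_
  · intro c _ i j hij hj
    exact (hlazy i j hij hj).2.2.2 c
  · intro c hc i j k l hij hjk hkl hl
    have h1 := hg i j hij (by omega)
    have h2 := hg j k hjk (by omega)
    have h3 := hg k l hkl hl
    have h4 := hgN l hl
    exact ht.ne (hsub [g i, g j, g k, g l] (by simp; omega) (by simp; omega)) hc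
  · intro i j k hij hjk hk
    exact (hlazy i j hij (by omega)).1.trans (hlazy i k (by omega) hk).1.symm
  · intro i j k hij hjk hk
    exact (hlazy i k (by omega) hk).2.1.trans (hlazy j k hjk hk).2.1.symm

theorem NowhereDense.exists_separator {C : Set FGraph} (hC : NowhereDense C) (r : ℕ) (ε : ℝ)
    (hε : 0 < ε) : ∃ s : ℕ, ∀ G ∈ C, ∀ A : Set G.V, ∃ S : Set G.V, S.ncard ≤ s ∧
      ∀ v, ((ballAvoiding G.G S r v ∩ A).ncard : ℝ) ≤ ε * (A.ncard : ℝ) := by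
  obtain ⟨m, hm⟩ := hC (3 * r)
  obtain ⟨N, hN⟩ := exists_isDepthMinor_top_of_isPlay (3 * r) m
  obtain ⟨s, hs⟩ := exists_separator_or_isPlay r ε hε N 0
  refine ⟨s, fun G hG A => ?_⟩
  rcases hs G.V G.G A [] Set.univ (by simp) with h | ⟨t, htN, ht⟩
  · simpa using h
  · exact absurd (hN G.V G.G t htN ht) (hm G hG)

/-- Two branch sets of a depth-`r` complete minor avoiding `S` have centers at distance at most
`2 * r + 1` outside `S`. -/
theorem mem_ballAvoiding_of_adj {V : Type} {G : SimpleGraph V} {S P Q : Set V} {r : ℕ}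
    {u : P} {w : Q} (hP : Disjoint P S) (hQ : Disjoint Q S)
    (hu : ∀ v : P, ∃ p : (G.induce P).Walk u v, p.length ≤ r)
    (hw : ∀ v : Q, ∃ p : (G.induce Q).Walk w v, p.length ≤ r)
    (hadj : ∃ x ∈ P, ∃ y ∈ Q, G.Adj x y) :
    (w : V) ∈ ballAvoiding G S (2 * r + 1) (u : V) := by
  have key : ∀ {P : Set V} {u : P}, Disjoint P S →
      (∀ v : P, ∃ p : (G.induce P).Walk u v, p.length ≤ r) → ∀ v ∈ P,
      v ∈ ballAvoiding G S r (u : V) := by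
    intro P u hP hu v hv
    obtain ⟨p, hp⟩ := hu ⟨v, hv⟩
    let f : G.induce P →g G := ⟨Subtype.val, fun h => h⟩
    refine ⟨p.map f, by simpa using hp, fun x hx => ?_⟩
    rw [Walk.support_map, List.mem_map] at hx
    obtain ⟨z, -, rfl⟩ := hx
    exact Set.disjoint_left.1 hP z.2
  obtain ⟨x, hx, y, hy, hxy⟩ := hadj
  have hstep : y ∈ ballAvoiding G S 1 x := by
    refine ⟨hxy.toWalk, by simp, fun z hz => ?_⟩
    have : z = x ∨ z = y := by simpa using hz
    rcases this with rfl | rfl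
    · exact Set.disjoint_left.1 hP hx
    · exact Set.disjoint_left.1 hQ hy
  have := mem_ballAvoiding_trans (mem_ballAvoiding_trans (key hP hu x hx) hstep)
    (mem_ballAvoiding_comm (key hQ hw y hy))
  rwa [show r + 1 + r = 2 * r + 1 by ring] at this

/-- A separator balancing the centers of a complete shallow minor has a positive proportion of its
size. -/
theorem le_two_mul_of_isDepthMinor_top {V : Type} [Finite V] {G : SimpleGraph V} {r m s : ℕ}
    (hG : IsDepthMinor r (⊤ : SimpleGraph (Fin m)) G)
    (hsep : ∀ A : Set V, ∃ S : Set V, S.ncard ≤ s ∧ ∀ v, v ∉ S →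
      ((ballAvoiding G S (2 * r + 1) v ∩ A).ncard : ℝ) ≤ 1 / 2 * (A.ncard : ℝ)) :
    m ≤ 2 * s := by
  classical
  obtain ⟨φ, hrad, hdisj, hadj⟩ := hG
  choose u hu using hrad
  have huinj : Function.Injective fun i => (u i : V) := by
    intro i j hij
    by_contra hne
    exact Set.disjoint_left.1 (hdisj hne) (u i).2 (by simp [hij])
  obtain ⟨S, hS, hball⟩ := hsep (Set.range fun i => (u i : V))
  by_contra! hm
  have hA : (Set.range fun i => (u i : V)).ncard = m := by
    rw [← Set.image_univ, Set.ncard_image_of_injective _ huinj]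
    simp
  obtain ⟨T, hT⟩ : ∃ T : Finset (Fin m), T = Finset.univ.filter fun i => ¬ Disjoint (φ i) S :=
    ⟨_, rfl⟩
  have hTS : T.card ≤ s := by
    have hex : ∀ i, ∃ x, x ∈ φ i ∧ (i ∈ T → x ∈ S) := by
      intro i
      by_cases hi : i ∈ T
      · have hiS := hi
        rw [hT, Finset.mem_filter] at hiS
        obtain ⟨x, hx, hxS⟩ := Set.not_disjoint_iff.1 hiS.2
        exact ⟨x, hx, fun _ => hxS⟩
      · exact ⟨u i, (u i).2, fun h => absurd h hi⟩
    choose x hxφ hxS using hex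
    refine le_trans ?_ hS
    rw [← Set.ncard_coe_finset T]
    refine Set.ncard_le_ncard_of_injOn x (fun i hi => hxS i hi) ?_ (Set.toFinite S)
    intro i hi j hj hij
    by_contra hne
    exact Set.disjoint_left.1 (hdisj hne) (hxφ i) (hij ▸ hxφ j)
  have hTc : m ≤ Tᶜ.card + s := by
    rw [Finset.card_compl, Fintype.card_fin]
    omega
  have hmem : ∀ i ∈ Tᶜ, Disjoint (φ i) S := by
    intro i hi
    simpa [hT] using hi
  obtain ⟨i, hi⟩ : Tᶜ.Nonempty := Finset.card_pos.1 (by omega)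
  have hsub : (fun j => (u j : V)) '' (Tᶜ : Finset (Fin m)) ⊆
      ballAvoiding G S (2 * r + 1) (u i) ∩ Set.range fun i => (u i : V) := by
    rintro _ ⟨j, hj, rfl⟩
    refine ⟨?_, j, rfl⟩
    rcases eq_or_ne i j with rfl | hij
    · exact ⟨Walk.nil, by simp, by simpa using Set.disjoint_left.1 (hmem i hi) (u i).2⟩
    · exact mem_ballAvoiding_of_adj (hmem i hi) (hmem j hj) (hu i) (hu j) (hadj i j hij)
  have hcard := Set.ncard_le_ncard hsub
  rw [Set.ncard_image_of_injective _ huinj, Set.ncard_coe_finset] at hcard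
  have hb := hball (u i) (Set.disjoint_left.1 (hmem i hi) (u i).2)
  rw [hA] at hb
  have h1 : (m : ℝ) ≤ (Tᶜ.card : ℝ) + s := by exact_mod_cast hTc
  have h2 : (Tᶜ.card : ℝ) ≤ 1 / 2 * m := le_trans (by exact_mod_cast hcard) hb
  have h3 : (2 * s : ℝ) < m := by exact_mod_cast hm
  linarith

/-- A class is nowhere dense iff it admits balanced neighborhood
separators. -/
theorem stmt2 (C : Set FGraph) :
    NowhereDense C ↔
      ∀ (r : ℕ) (ε : ℝ), 0 < ε → ∃ s : ℕ, ∀ G ∈ C, ∀ A : Set G.V,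
        ∃ S : Set G.V, S.ncard ≤ s ∧
          ∀ v : G.V, v ∉ S →
            ((ballAvoiding G.G S r v ∩ A).ncard : ℝ) ≤ ε * (A.ncard : ℝ) := by
  constructor
  · intro hC r ε hε
    obtain ⟨s, hs⟩ := hC.exists_separator r ε hε
    refine ⟨s, fun G hG A => ?_⟩
    obtain ⟨S, hS, h⟩ := hs G hG A
    exact ⟨S, hS, fun v _ => h v⟩
  · intro hsep r
    obtain ⟨s, hs⟩ := hsep (2 * r + 1) (1 / 2) (by norm_num)
    refine ⟨2 * s + 1, fun G hG hminor => ?_⟩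
    have := le_two_mul_of_isDepthMinor_top hminor (hs G hG)
    omega
end
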